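/- arXiv:1809.05265 — 7 statements merged into one kernel-verified Lean document; each statement's English description precedes it below -/
import Mathlib

section
/- Let n ≥ 1 and let 𝓑 be a family of balanced bipartite graphs of order 2n, all with the same bipartition into parts X and Y with |X| = |Y| = n, such that: (1) for every G ∈ 𝓑, every edge of G is contained in some Hamilton cycle of G; and (2) for every G ∈ 𝓑 and every pair of nonadjacent vertices x ∈ X, y ∈ Y, the graph G + xy obtained from G by adding the edge xy also belongs to 𝓑. Then every graph in 𝓑 is weakly Hamilton-connected. -/
open SimpleGraph

/-- The degree of a vertex `v` in a graph `G`. -/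
noncomputable def deg {V : Type*} (G : SimpleGraph V) (v : V) : ℕ := {u | G.Adj v u}.ncard

/-- The number of edges of `G`. -/
noncomputable def numEdges {V : Type*} (G : SimpleGraph V) : ℕ := G.edgeSet.ncard

/-- `G` is a balanced bipartite graph with parts `X` and `Xᶜ`, each of size `n`:
every edge joins `X` to `Xᶜ`. -/
def IsBalancedBipartition {V : Type*} [Fintype V] [DecidableEq V]
    (G : SimpleGraph V) (X : Finset V) (n : ℕ) : Prop :=
  X.card = n ∧ Xᶜ.card = n ∧ ∀ u v, G.Adj u v → (u ∈ X ↔ v ∉ X)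

/-- `G` (with parts `X` and `Xᶜ`) is weakly Hamilton-connected: any `x ∈ X` and `y ∈ Xᶜ`
are joined by a Hamilton path of `G`. -/
def WeaklyHamiltonConnected {V : Type*} [Fintype V] [DecidableEq V]
    (G : SimpleGraph V) (X : Finset V) : Prop :=
  ∀ x ∈ X, ∀ y ∈ Xᶜ, ∃ p : G.Walk x y, p.IsHamiltonian

namespace SimpleGraph.Walk

variable {V : Type*} [DecidableEq V] {G : SimpleGraph V} {x y : V}

lemma IsHamiltonianCycle.reverse [Fintype V] {c : G.Walk x x} (hc : c.IsHamiltonianCycle) :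
    c.reverse.IsHamiltonianCycle := by
  rw [isHamiltonianCycle_iff_isCycle_and_length_eq] at hc ⊢
  exact ⟨hc.1.reverse, by simpa using hc.2⟩

/-- Deleting the first edge of a Hamiltonian cycle leaves a Hamiltonian path avoiding it. -/
lemma IsHamiltonianCycle.exists_isHamiltonian_of_snd_eq {c : G.Walk x x}
    (hc : c.IsHamiltonianCycle) (hy : c.snd = y) :
    ∃ p : G.Walk y x, p.IsHamiltonian ∧ s(x, y) ∉ p.edges := by
  subst hy
  refine ⟨c.tail, hc.isHamiltonian_tail, ?_⟩
  have hnodup := hc.isCycle.isTrail.edges_nodup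
  rw [← cons_tail_eq c hc.isCycle.not_nil, edges_cons, List.nodup_cons] at hnodup
  exact hnodup.1

/-- Deleting an edge of a Hamiltonian cycle leaves a Hamiltonian path avoiding it. -/
lemma IsHamiltonianCycle.exists_isHamiltonian_of_mem_edges [Fintype V] {v : V} {c : G.Walk v v}
    (hc : c.IsHamiltonianCycle) (he : s(x, y) ∈ c.edges) :
    ∃ p : G.Walk x y, p.IsHamiltonian ∧ s(x, y) ∉ p.edges := by
  have hy := hc.mem_support y
  have hd : (c.rotate y hy).IsHamiltonianCycle := hc.rotate hy
  have hmem : s(y, x) ∈ (c.rotate y hy).edges := by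
    rw [Sym2.eq_swap]
    exact (rotate_edges c y hy).perm.mem_iff.2 he
  generalize c.rotate y hy = d at hd hmem
  rw [Sym2.eq_swap]
  by_cases hx : d.snd = x
  · exact hd.exists_isHamiltonian_of_snd_eq hx
  · refine hd.reverse.exists_isHamiltonian_of_snd_eq ?_
    have hnil := hd.isCycle.not_nil
    cases d with
    | nil => simp at hnil
    | cons h p =>
      have hp : p.IsPath := by simpa using hd.isCycle.isPath_tail
      have hmem' : s(y, x) ∈ p.edges := by
        rw [edges_cons, List.mem_cons] at hmem
        refine hmem.resolve_left fun heq => hx ?_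
        simpa using (Sym2.congr_right.1 heq).symm
      have hpn : ¬ p.Nil := fun hn => h.ne hn.eq.symm
      rw [snd_reverse, penultimate_cons_of_not_nil _ _ hpn]
      exact (hp.eq_penultimate_of_mem_edges (Sym2.eq_swap ▸ hmem')).symm

lemma IsHamiltonian.transfer {H : SimpleGraph V} {p : G.Walk x y} (hp : p.IsHamiltonian)
    (h : ∀ e ∈ p.edges, e ∈ H.edgeSet) : (p.transfer H h).IsHamiltonian := by
  simpa [IsHamiltonian] using hp

end SimpleGraph.Walk

theorem stmt0 {V : Type*} [Fintype V] [DecidableEq V] (n : ℕ) (hn : 1 ≤ n)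
    (X : Finset V) (𝓑 : Set (SimpleGraph V))
    (hbip : ∀ G ∈ 𝓑, IsBalancedBipartition G X n)
    (h1 : ∀ G ∈ 𝓑, ∀ e ∈ G.edgeSet,
      ∃ (v : V) (c : G.Walk v v), c.IsHamiltonianCycle ∧ e ∈ c.edges)
    (h2 : ∀ G ∈ 𝓑, ∀ x ∈ X, ∀ y ∈ Xᶜ, ¬ G.Adj x y →
      (G ⊔ SimpleGraph.fromEdgeSet {s(x, y)}) ∈ 𝓑) :
    ∀ G ∈ 𝓑, WeaklyHamiltonConnected G X := by
  intro G hG x hx y hy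
  by_cases hxy : G.Adj x y
  · obtain ⟨v, c, hc, he⟩ := h1 G hG s(x, y) hxy
    obtain ⟨p, hp, -⟩ := hc.exists_isHamiltonian_of_mem_edges he
    exact ⟨p, hp⟩
  · have hne : x ≠ y := fun h => Finset.mem_compl.1 hy (h ▸ hx)
    obtain ⟨v, c, hc, he⟩ := h1 _ (h2 G hG x hx y hy hxy) s(x, y) (by simp [hne])
    obtain ⟨p, hp, hpe⟩ := hc.exists_isHamiltonian_of_mem_edges he
    refine ⟨p.transfer G fun e hep => ?_, hp.transfer _⟩
    have hmem := p.edges_subset_edgeSet hep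
    rw [edgeSet_sup, edgeSet_fromEdgeSet] at hmem
    exact hmem.resolve_right fun hs => hpe (Set.mem_singleton_iff.1 hs.1 ▸ hep)
end

section
/- Let G be a balanced bipartite graph with parts X and Y, |X| = |Y| = n. If d(x) + d(y) ≥ n + 2 for every pair of nonadjacent vertices x ∈ X and y ∈ Y, then G is weakly Hamilton-connected. -/
open SimpleGraph

/-- `p 0, p 1, …, p (2 * n - 1)` lists distinct vertices from `x` to `y`, alternating between
`X` (at even positions) and `Xᶜ` (at odd positions); adjacency is not required. -/
structure IsAlternating {V : Type*} (X : Finset V) (n : ℕ) (x y : V) (p : ℕ → V) : Prop where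
  inj : ∀ i < 2 * n, ∀ j < 2 * n, p i = p j → i = j
  mem_iff : ∀ i < 2 * n, (p i ∈ X ↔ i % 2 = 0)
  first : p 0 = x
  last : p (2 * n - 1) = y

open Classical in
/-- The positions `i` at which consecutive terms `p i` and `p (i + 1)` are not adjacent. -/
noncomputable def gaps {V : Type*} (G : SimpleGraph V) (N : ℕ) (p : ℕ → V) : Finset ℕ :=
  {i ∈ Finset.range N | i + 1 < N ∧ ¬ G.Adj (p i) (p (i + 1))}

theorem mem_gaps {V : Type*} {G : SimpleGraph V} {N : ℕ} {p : ℕ → V} {i : ℕ} :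
    i ∈ gaps G N p ↔ i + 1 < N ∧ ¬ G.Adj (p i) (p (i + 1)) := by
  simp only [gaps, Finset.mem_filter, Finset.mem_range]
  constructor
  · exact fun h => h.2
  · exact fun h => ⟨by omega, h⟩

/-- The involution of `ℕ` reversing the segment `s + 1, …, t`. -/
def reverseSegment (s t i : ℕ) : ℕ := if s < i ∧ i ≤ t then s + 1 + t - i else i

theorem IsAlternating.comp_reverseSegment {V : Type*} {X : Finset V} {n : ℕ} {x y : V}
    {p : ℕ → V} (hp : IsAlternating X n x y p) {s t : ℕ} (ht : t + 1 < 2 * n)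
    (hodd : (s + t) % 2 = 1) : IsAlternating X n x y (p ∘ reverseSegment s t) where
  inj i hi j hj h := by
    have hi' : reverseSegment s t i < 2 * n := by unfold reverseSegment; split_ifs <;> omega
    have hj' : reverseSegment s t j < 2 * n := by unfold reverseSegment; split_ifs <;> omega
    have := hp.inj _ hi' _ hj' h
    unfold reverseSegment at this
    split_ifs at this <;> omega
  mem_iff i hi := by
    have hi' : reverseSegment s t i < 2 * n := by unfold reverseSegment; split_ifs <;> omega
    rw [Function.comp_apply, hp.mem_iff _ hi']
    unfold reverseSegment
    split_ifs <;> omega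
  first := by simpa [reverseSegment] using hp.first
  last := by
    have : reverseSegment s t (2 * n - 1) = 2 * n - 1 := by
      unfold reverseSegment; split_ifs <;> omega
    rw [Function.comp_apply, this, hp.last]

theorem card_gaps_comp_reverseSegment_lt {V : Type*} {G : SimpleGraph V} {N : ℕ} {p : ℕ → V}
    {s t : ℕ} (hst : s < t) (ht : t + 1 < N) (h₁ : G.Adj (p s) (p t))
    (h₂ : G.Adj (p (s + 1)) (p (t + 1))) (hgap : s ∈ gaps G N p ∨ t ∈ gaps G N p) :
    (gaps G N (p ∘ reverseSegment s t)).card < (gaps G N p).card := by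
  have hmem : ∀ i ∈ gaps G N (p ∘ reverseSegment s t), i ≠ s ∧ i ≠ t ∧
      (if s < i ∧ i < t then s + t - i else i) ∈ gaps G N p := by
    intro i hi
    rw [mem_gaps] at hi
    obtain ⟨hiN, hi⟩ := hi
    have his : i ≠ s := by
      rintro rfl
      have e₁ : reverseSegment i t i = i := by simp [reverseSegment]
      have e₂ : reverseSegment i t (i + 1) = t := by
        unfold reverseSegment; split_ifs <;> omega
      exact hi (by simpa only [Function.comp_apply, e₁, e₂] using h₁)
    have hit : i ≠ t := by
      rintro rfl
      have e₁ : reverseSegment s i i = s + 1 := by unfold reverseSegment; split_ifs <;> omega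
      have e₂ : reverseSegment s i (i + 1) = i + 1 := by
        unfold reverseSegment; split_ifs <;> omega
      exact hi (by simpa only [Function.comp_apply, e₁, e₂] using h₂)
    refine ⟨his, hit, ?_⟩
    split_ifs with h
    · have e₁ : reverseSegment s t i = s + t - i + 1 := by
        unfold reverseSegment; split_ifs <;> omega
      have e₂ : reverseSegment s t (i + 1) = s + t - i := by
        unfold reverseSegment; split_ifs <;> omega
      rw [mem_gaps]
      refine ⟨by omega, fun hadj => hi ?_⟩
      simpa only [Function.comp_apply, e₁, e₂] using hadj.symm
    · have e₁ : reverseSegment s t i = i := by unfold reverseSegment; split_ifs <;> omega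
      have e₂ : reverseSegment s t (i + 1) = i + 1 := by
        unfold reverseSegment; split_ifs <;> omega
      rw [mem_gaps]
      refine ⟨hiN, fun hadj => hi ?_⟩
      simpa only [Function.comp_apply, e₁, e₂] using hadj
  have key : ∀ r ∈ gaps G N p, r = s ∨ r = t →
      (gaps G N (p ∘ reverseSegment s t)).card < (gaps G N p).card := by
    intro r hr hrst
    rw [← Finset.card_erase_add_one hr, Nat.lt_succ_iff]
    refine Finset.card_le_card_of_injOn (fun i => if s < i ∧ i < t then s + t - i else i) ?_ ?_
    · intro i hi
      obtain ⟨his, hit, h⟩ := hmem i hi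
      refine Finset.mem_coe.2 (Finset.mem_erase.2 ⟨?_, h⟩)
      dsimp only
      split_ifs <;> omega
    · intro i _ j _ h
      dsimp only at h
      split_ifs at h <;> omega
  rcases hgap with h | h
  · exact key s h (Or.inl rfl)
  · exact key t h (Or.inr rfl)

theorem IsAlternating.exists_eq {V : Type*} [Fintype V] {X : Finset V} {n : ℕ} {x y : V}
    {p : ℕ → V} (hp : IsAlternating X n x y p) (hV : Fintype.card V = 2 * n) (v : V) :
    ∃ i < 2 * n, p i = v := by
  classical
  have hinj : Set.InjOn p (Finset.range (2 * n)) := fun i hi j hj h =>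
    hp.inj i (by simpa using hi) j (by simpa using hj) h
  have h : (Finset.range (2 * n)).image p = Finset.univ := by
    rw [← Finset.card_eq_iff_eq_univ, Finset.card_image_of_injOn hinj, Finset.card_range, hV]
  have hv : v ∈ (Finset.range (2 * n)).image p := by rw [h]; exact Finset.mem_univ v
  simpa using hv

theorem deg_le_card {V : Type*} {G : SimpleGraph V} {v : V} {T : Finset ℕ} (f : ℕ → V)
    (h : ∀ w, G.Adj v w → ∃ i ∈ T, f i = w) : deg G v ≤ T.card := by
  classical
  calc deg G v ≤ (T.image f : Set V).ncard :=
        Set.ncard_le_ncard (fun w hw => by simpa using h w hw) (Finset.finite_toSet _)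
    _ = (T.image f).card := Set.ncard_coe_finset _
    _ ≤ T.card := Finset.card_image_le

theorem card_filter_parity_le (n k : ℕ) :
    ((Finset.range (2 * n)).filter (fun i => i % 2 ≠ k % 2)).card ≤ n := by
  calc _ ≤ ((Finset.range n).image (fun j => 2 * j + (1 - k % 2))).card := by
        refine Finset.card_le_card fun i hi => ?_
        simp only [Finset.mem_filter, Finset.mem_range] at hi
        simp only [Finset.mem_image, Finset.mem_range]
        exact ⟨i / 2, by omega, by omega⟩
    _ ≤ n := Finset.card_image_le.trans (Finset.card_range n).le

/-- If the degree sum of `p k` and `p (k + 1)` is at least `n + 2`, there is another position `m`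
at which the pairs `p k, p m` and `p (k + 1), p (m + 1)` are both adjacent. -/
theorem IsAlternating.exists_crossing {V : Type*} [Fintype V] {G : SimpleGraph V} {X : Finset V}
    {n : ℕ} {x y : V} {p : ℕ → V} (hp : IsAlternating X n x y p)
    (hV : Fintype.card V = 2 * n) (hG : ∀ u v, G.Adj u v → (u ∈ X ↔ v ∉ X)) {k : ℕ}
    (hk : k + 1 < 2 * n) (hdeg : n + 2 ≤ deg G (p k) + deg G (p (k + 1))) :
    ∃ m, m + 1 < 2 * n ∧ m % 2 ≠ k % 2 ∧
      G.Adj (p k) (p m) ∧ G.Adj (p (k + 1)) (p (m + 1)) := by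
  classical
  have hpar : ∀ i < 2 * n, ∀ j < 2 * n, G.Adj (p i) (p j) → i % 2 ≠ j % 2 := by
    intro i hi j hj h
    have := hG _ _ h
    rw [hp.mem_iff i hi, hp.mem_iff j hj] at this
    omega
  let S := (Finset.range (2 * n)).filter (fun i => G.Adj (p k) (p i))
  let T := (Finset.range (2 * n)).filter (fun i => G.Adj (p (k + 1)) (p ((i + 1) % (2 * n))))
  have hS : deg G (p k) ≤ S.card := by
    refine deg_le_card p fun w hw => ?_
    obtain ⟨i, hi, rfl⟩ := hp.exists_eq hV w
    exact ⟨i, by simp [S, hi, hw], rfl⟩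
  have hT : deg G (p (k + 1)) ≤ T.card := by
    refine deg_le_card (fun i => p ((i + 1) % (2 * n))) fun w hw => ?_
    obtain ⟨i, hi, rfl⟩ := hp.exists_eq hV w
    obtain ⟨j, hj, hji⟩ : ∃ j < 2 * n, (j + 1) % (2 * n) = i := by
      rcases i with _ | i
      · exact ⟨2 * n - 1, by omega, by rw [Nat.sub_add_cancel (by omega), Nat.mod_self]⟩
      · exact ⟨i, by omega, Nat.mod_eq_of_lt hi⟩
    exact ⟨j, by simp [T, hj, hji, hw], by simp only [hji]⟩
  have hsub : S ∪ T ⊆ (Finset.range (2 * n)).filter (fun i => i % 2 ≠ k % 2) := by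
    intro i hi
    rw [Finset.mem_union] at hi
    simp only [S, T, Finset.mem_filter, Finset.mem_range] at hi ⊢
    rcases hi with ⟨hi, h⟩ | ⟨hi, h⟩
    · exact ⟨hi, (hpar k (by omega) i hi h).symm⟩
    · refine ⟨hi, ?_⟩
      have h' := hpar _ hk _ (Nat.mod_lt _ (by omega)) h
      rw [Nat.mod_mul_right_mod] at h'
      omega
  have hle := (Finset.card_le_card hsub).trans (card_filter_parity_le n k)
  have hcard := Finset.card_union_add_card_inter S T
  obtain ⟨m, hm, hne⟩ := Finset.exists_mem_ne (s := S ∩ T) (by omega) (2 * n - 1)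
  have hmem := hsub (Finset.mem_union_left T (Finset.mem_inter.1 hm).1)
  simp only [S, T, Finset.mem_inter, Finset.mem_filter, Finset.mem_range] at hm hmem
  have hlt : m + 1 < 2 * n := by omega
  refine ⟨m, hlt, hmem.2, hm.1.2, ?_⟩
  simpa only [Nat.mod_eq_of_lt hlt] using hm.2.2

theorem exists_enumeration {V : Type*} {X : Finset V} {n : ℕ} (hX : X.card = n) {x : V}
    (hx : x ∈ X) {k : ℕ} (hk : k < n) :
    ∃ e : ℕ → V, e k = x ∧ (∀ i < n, e i ∈ X) ∧ ∀ i < n, ∀ j < n, e i = e j → i = j := by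
  classical
  let f := X.equivFinOfCardEq hX
  let g : Fin n ≃ X := (Equiv.swap ⟨k, hk⟩ (f ⟨x, hx⟩)).trans f.symm
  refine ⟨fun i => if h : i < n then (g ⟨i, h⟩ : V) else x, ?_, ?_, ?_⟩
  · simp [hk, g]
  · intro i hi
    simp [hi]
  · intro i hi j hj h
    simpa [hi, hj, Subtype.coe_inj] using h

theorem exists_isAlternating {V : Type*} [Fintype V] [DecidableEq V] {X : Finset V} {n : ℕ}
    (hX : X.card = n) (hY : Xᶜ.card = n) {x y : V} (hx : x ∈ X) (hy : y ∈ Xᶜ) :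
    ∃ p, IsAlternating X n x y p := by
  have hn : 0 < n := hX ▸ Finset.card_pos.2 ⟨x, hx⟩
  obtain ⟨e, he, heX, he_inj⟩ := exists_enumeration hX hx hn
  obtain ⟨f, hf, hfY, hf_inj⟩ := exists_enumeration hY hy (Nat.sub_lt hn one_pos)
  have hmem : ∀ i < 2 * n, ((if i % 2 = 0 then e (i / 2) else f (i / 2)) ∈ X ↔ i % 2 = 0) := by
    intro i hi
    split_ifs with h
    · simp [h, heX (i / 2) (by omega)]
    · simpa [h] using hfY (i / 2) (by omega)
  refine ⟨fun i => if i % 2 = 0 then e (i / 2) else f (i / 2), ?_, hmem, by simpa using he, ?_⟩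
  · intro i hi j hj h
    have hij : i % 2 = 0 ↔ j % 2 = 0 := by
      rw [← hmem i hi, ← hmem j hj]
      exact iff_of_eq (congrArg (· ∈ X) h)
    split_ifs at h
    · have := he_inj _ (by omega) _ (by omega) h
      omega
    · omega
    · omega
    · have := hf_inj _ (by omega) _ (by omega) h
      omega
  · have h₁ : (2 * n - 1) % 2 ≠ 0 := by omega
    have h₂ : (2 * n - 1) / 2 = n - 1 := by omega
    simp [h₁, h₂, hf]

theorem exists_walk_support_eq_map {V : Type*} {G : SimpleGraph V} (p : ℕ → V) (k : ℕ)
    (h : ∀ i < k, G.Adj (p i) (p (i + 1))) :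
    ∃ w : G.Walk (p 0) (p k), w.support = (List.range (k + 1)).map p := by
  induction k with
  | zero => exact ⟨Walk.nil, by simp⟩
  | succ k ih =>
    obtain ⟨w, hw⟩ := ih fun i hi => h i (by omega)
    refine ⟨w.concat (h k (by omega)), ?_⟩
    rw [Walk.support_concat, hw, List.range_succ (n := k + 1)]
    simp

theorem IsAlternating.exists_isHamiltonian {V : Type*} [Fintype V] [DecidableEq V]
    {G : SimpleGraph V} {X : Finset V} {n : ℕ} {x y : V} {p : ℕ → V}
    (hp : IsAlternating X n x y p) (hn : 0 < n) (hV : Fintype.card V = 2 * n)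
    (hgaps : gaps G (2 * n) p = ∅) : ∃ w : G.Walk x y, w.IsHamiltonian := by
  obtain ⟨w, hw⟩ := exists_walk_support_eq_map (G := G) p (2 * n - 1) fun i hi => by
    by_contra h
    have : i ∈ gaps G (2 * n) p := mem_gaps.2 ⟨by omega, h⟩
    simp [hgaps] at this
  obtain rfl := hp.first
  obtain rfl := hp.last
  refine ⟨w, fun v => List.count_eq_one_of_mem ?_ ?_⟩
  · rw [hw]
    refine List.Nodup.map_on (fun i hi j hj h => hp.inj i ?_ j ?_ h) List.nodup_range
    · have := List.mem_range.1 hi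
      omega
    · have := List.mem_range.1 hj
      omega
  · rw [hw]
    obtain ⟨i, hi, rfl⟩ := hp.exists_eq hV v
    exact List.mem_map_of_mem (List.mem_range.2 (by omega))

theorem stmt2 {V : Type*} [Fintype V] [DecidableEq V] (n : ℕ)
    (G : SimpleGraph V) (X : Finset V)
    (hbip : IsBalancedBipartition G X n)
    (hdeg : ∀ x ∈ X, ∀ y ∈ Xᶜ, ¬ G.Adj x y → n + 2 ≤ deg G x + deg G y) :
    WeaklyHamiltonConnected G X := by
  obtain ⟨hX, hY, hG⟩ := hbip
  intro x hx y hy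
  have hn : 0 < n := hX ▸ Finset.card_pos.2 ⟨x, hx⟩
  have hV : Fintype.card V = 2 * n := by
    rw [← Finset.card_add_card_compl X, hX, hY, two_mul]
  obtain ⟨p, hp, hmin⟩ := WellFounded.has_min
    (InvImage.wf (fun p => (gaps G (2 * n) p).card) Nat.lt_wfRel.wf)
    {p | IsAlternating X n x y p} (exists_isAlternating hX hY hx hy)
  refine IsAlternating.exists_isHamiltonian hp hn hV (Finset.eq_empty_of_forall_notMem ?_)
  intro k hk
  obtain ⟨hkn, hadj⟩ := mem_gaps.1 hk
  have hsum : n + 2 ≤ deg G (p k) + deg G (p (k + 1)) := by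
    have h₁ := hp.mem_iff k (by omega)
    have h₂ := hp.mem_iff (k + 1) hkn
    rcases Nat.mod_two_eq_zero_or_one k with h | h
    · exact hdeg _ (h₁.2 h) _ (Finset.mem_compl.2 fun h' => by have := h₂.1 h'; omega) hadj
    · rw [add_comm (deg G (p k))]
      exact hdeg _ (h₂.2 (by omega)) _ (Finset.mem_compl.2 fun h' => by have := h₁.1 h'; omega)
        fun h' => hadj h'.symm
  obtain ⟨m, hmn, hpar, hkm, hkm'⟩ := hp.exists_crossing hV hG hkn hsum
  rcases lt_or_gt_of_ne (fun h : m = k => hpar (congrArg (· % 2) h)) with h | h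
  · exact hmin _ (hp.comp_reverseSegment hkn (by omega))
      (card_gaps_comp_reverseSegment_lt h hkn hkm.symm hkm'.symm (Or.inr hk))
  · exact hmin _ (hp.comp_reverseSegment hmn (by omega))
      (card_gaps_comp_reverseSegment_lt h hmn hkm hkm' (Or.inl hk))
end

section
/- Let G be a balanced bipartite graph with parts X and Y, |X| = |Y| = n, and let x ∈ X and y ∈ Y be nonadjacent vertices with d(x) + d(y) ≥ n + 2. Then G is weakly Hamilton-connected if and only if the graph G + xy obtained from G by adding the edge xy is weakly Hamilton-connected. -/
open SimpleGraph

/-- If `c, v` and `p, q` are consecutive in a list `l`, then replacing the links `p — q` and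
`c — v` by `p — c` and `q — v` turns `l` into a chain with the same ends. -/
theorem List.exists_perm_isChain_of_crossing {V : Type*} {R : V → V → Prop}
    (hR : ∀ {a b}, R a b → R b a) (hirr : ∀ a, ¬ R a a) {A B L₁ L₂ : List V} {p q c v : V}
    (hl : A ++ p :: q :: B = L₁ ++ c :: v :: L₂)
    (hA : (A ++ [p]).IsChain R) (hB : (q :: B).IsChain R)
    (hpc : R p c) (hqv : R q v) :
    ∃ l : List V, l.Perm (A ++ p :: q :: B) ∧ l.IsChain R ∧
      l.head? = (A ++ p :: q :: B).head? ∧ l.getLast? = (A ++ p :: q :: B).getLast? := by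
  have hflip : (fun a b => R b a) = R := by
    funext a b
    exact propext ⟨hR, hR⟩
  have hrev : ∀ {l : List V}, l.IsChain R → l.reverse.IsChain R := fun h => by
    rw [List.isChain_reverse]
    simpa only [flip, hflip] using h
  rcases List.append_eq_append_iff.1 hl with ⟨M, rfl, hM⟩ | ⟨M, rfl, hM⟩
  · cases M with
    | nil =>
      obtain ⟨rfl, -⟩ : p = c ∧ _ := by simpa using hM
      exact (hirr _ hpc).elim
    | cons m M =>
      obtain ⟨rfl, hM⟩ : p = m ∧ q :: B = M ++ c :: v :: L₂ := by simpa using hM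
      have hM' : q :: B = (M ++ [c]) ++ v :: L₂ := by simpa using hM
      rw [hM', List.isChain_append] at hB
      obtain ⟨hB₁, hB₂, -⟩ := hB
      have hq : (M ++ [c]).head? = some q := by
        have := congrArg List.head? hM'
        cases M <;> simp_all
      refine ⟨(A ++ [p]) ++ ((M ++ [c]).reverse ++ v :: L₂), ?_, ?_, ?_, ?_⟩
      · rw [show A ++ p :: q :: B = (A ++ [p]) ++ ((M ++ [c]) ++ v :: L₂) by simp [hM]]
        exact ((List.reverse_perm _).append_right _).append_left _
      · refine hA.append ((hrev hB₁).append hB₂ ?_) ?_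
        · simp only [List.getLast?_reverse, hq]
          simpa using hqv
        · simpa using hpc
      · simp [List.head?_append]
      · simp [hM, List.getLast?_append, List.getLast?_cons]
  · cases M with
    | nil =>
      obtain ⟨rfl, -⟩ : c = p ∧ _ := by simpa using hM
      exact (hirr _ hpc).elim
    | cons m M =>
      obtain ⟨rfl, hM⟩ : c = m ∧ v :: L₂ = M ++ p :: q :: B := by simpa using hM
      rw [show L₁ ++ c :: M ++ [p] = (L₁ ++ [c]) ++ (M ++ [p]) by simp,
        List.isChain_append] at hA
      obtain ⟨hA₁, hA₂, -⟩ := hA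
      have hv : (M ++ [p]).head? = some v := by
        have := congrArg List.head? hM
        cases M <;> simp_all
      refine ⟨(L₁ ++ [c]) ++ ((M ++ [p]).reverse ++ q :: B), ?_, ?_, ?_, ?_⟩
      · rw [show L₁ ++ c :: M ++ p :: q :: B = (L₁ ++ [c]) ++ ((M ++ [p]) ++ q :: B) by simp]
        exact ((List.reverse_perm _).append_right _).append_left _
      · refine hA₁.append ((hrev hA₂).append hB ?_) ?_
        · simp only [List.getLast?_reverse, hv]
          simpa using hR hqv
        · simpa using hR hpc
      · simp [List.head?_append]
      · simp [List.getLast?_append, List.getLast?_cons]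

/-- If `N` and `M` are sets of elements of a duplicate-free list `l`, where `N` and the set of
predecessors of elements of `M` both lie in a set `S` smaller than `|N| + |M| - 1`, then an
element of `N` is the predecessor of an element of `M`. -/
theorem List.Nodup.exists_consecutive_of_card_lt {V : Type*} [DecidableEq V] {l : List V}
    (hnd : l.Nodup) {N M S : Finset V} (hN : N ⊆ S) (hM : ∀ v ∈ M, v ∈ l)
    (hS : ∀ L₁ c v L₂, l = L₁ ++ c :: v :: L₂ → v ∈ M → c ∈ S)
    (hcard : S.card + 1 < N.card + M.card) :
    ∃ L₁ c v L₂, l = L₁ ++ c :: v :: L₂ ∧ c ∈ N ∧ v ∈ M := by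
  by_contra! hno
  cases l with
  | nil =>
    have : M = ∅ := Finset.eq_empty_of_forall_notMem fun v hv => by simpa using hM v hv
    have := Finset.card_le_card hN
    simp_all
    omega
  | cons a l =>
    have h₁ : (M.erase a).card ≤ (S \ N).card := by
      refine Finset.card_le_card_of_forall_subsingleton
        (fun v c => ∃ L₁ L₂, a :: l = L₁ ++ c :: v :: L₂) ?_ ?_
      · intro v hv
        obtain ⟨hva, hvM⟩ := Finset.mem_erase.1 hv
        obtain ⟨L₁, L₂, hL⟩ := List.append_of_mem (hM v hvM)
        rcases List.eq_nil_or_concat' L₁ with rfl | ⟨L, c, rfl⟩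
        · simp_all
        · have hL' : a :: l = L ++ c :: v :: L₂ := by simpa using hL
          exact ⟨c, Finset.mem_sdiff.2 ⟨hS _ _ _ _ hL' hvM,
            fun hc => hno _ _ _ _ hL' hc hvM⟩, L, L₂, hL'⟩
      · rintro c - v ⟨-, L₁, L₂, h⟩ w ⟨-, K₁, K₂, h'⟩
        have hn := hnd
        rw [h] at hn
        have h'' := h.symm.trans h'
        have hc₁ : c ∉ L₁ := by grind
        have hc₂ : c ∉ K₁ := by grind
        rcases List.append_eq_append_iff.1 h'' with ⟨J, rfl, hJ⟩ | ⟨J, rfl, hJ⟩ <;>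
          cases J <;> simp_all
    have h₂ : M.card ≤ (M.erase a).card + 1 := by
      have := Finset.pred_card_le_card_erase (s := M) (a := a)
      omega
    have h₃ := Finset.card_sdiff_add_card_eq_card hN
    omega

namespace SimpleGraph

theorem exists_isHamiltonian_of_isChain {V : Type*} [DecidableEq V] {G : SimpleGraph V}
    {a b : V} {l : List V} (hl : l.IsChain G.Adj) (ha : l.head? = some a)
    (hb : l.getLast? = some b) (hcount : ∀ v, l.count v = 1) :
    ∃ w : G.Walk a b, w.IsHamiltonian := by
  have hne : l ≠ [] := by
    rintro rfl
    simp at ha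
  obtain rfl : l.head hne = a := by simpa [List.head?_eq_some_head hne] using ha
  obtain rfl : l.getLast hne = b := by simpa [List.getLast?_eq_some_getLast hne] using hb
  exact ⟨Walk.ofSupport l hne hl, fun v => by rw [Walk.support_ofSupport]; exact hcount v⟩

/-- Ore-type exchange: in a Hamilton path of `G + pq` that traverses `pq`, the edge can be
avoided when `p` and `q` have large degree sum. -/
theorem exists_isChain_of_isChain_sup_edge {V : Type*} [Fintype V] [DecidableEq V] {n : ℕ}
    {G : SimpleGraph V} {X : Finset V} (hbip : IsBalancedBipartition G X n) {p q : V}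
    (hpq : p ∈ X ↔ q ∉ X) (hdeg : n + 2 ≤ deg G p + deg G q) {A B : List V}
    (hl : (A ++ p :: q :: B).IsChain (G ⊔ fromEdgeSet {s(p, q)}).Adj)
    (hcount : ∀ v, (A ++ p :: q :: B).count v = 1) :
    ∃ l : List V, l.Perm (A ++ p :: q :: B) ∧ l.IsChain G.Adj ∧
      l.head? = (A ++ p :: q :: B).head? ∧ l.getLast? = (A ++ p :: q :: B).getLast? := by
  classical
  obtain ⟨hX, hXc, hG⟩ := hbip
  have hnd : (A ++ p :: q :: B).Nodup := List.nodup_iff_count_le_one.2 fun v => (hcount v).le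
  have hmem : ∀ v, v ∈ A ++ p :: q :: B := fun v =>
    List.count_pos_iff.1 (by rw [hcount v]; exact one_pos)
  have hadj : ∀ u v, (G ⊔ fromEdgeSet {s(p, q)}).Adj u v →
      G.Adj u v ∨ (u = p ∧ v = q) ∨ (u = q ∧ v = p) := by
    intro u v h
    simp only [sup_adj, fromEdgeSet_adj, Set.mem_singleton_iff, Sym2.eq_iff] at h
    tauto
  have hcross : ∀ u v, (G ⊔ fromEdgeSet {s(p, q)}).Adj u v → (u ∈ X ↔ v ∉ X) := by
    intro u v h
    rcases hadj u v h with h | ⟨rfl, rfl⟩ | ⟨rfl, rfl⟩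
    · exact hG u v h
    · exact hpq
    · tauto
  have hS : (Finset.univ.filter fun c => c ∈ X ↔ q ∈ X).card = n := by
    by_cases hq : q ∈ X
    · simpa [hq] using hX
    · rw [← hXc]
      congr 1
      ext c
      simp [hq]
  have hdeg_eq : ∀ u, deg G u = (Finset.univ.filter fun c => G.Adj u c).card := by
    intro u
    rw [deg, ← Set.ncard_coe_finset]
    simp
  obtain ⟨L₁, c, v, L₂, hL, hc, hv⟩ := hnd.exists_consecutive_of_card_lt
    (N := Finset.univ.filter fun c => G.Adj p c) (M := Finset.univ.filter fun c => G.Adj q c)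
    (S := Finset.univ.filter fun c => c ∈ X ↔ q ∈ X)
    (fun c hc => by
      have := hG p c (by simpa using hc)
      simp only [Finset.mem_filter, Finset.mem_univ, true_and]
      tauto)
    (fun v _ => hmem v)
    (fun L₁ c v L₂ h hv => by
      have h₁ := hG q v (by simpa using hv)
      have h₂ := hcross c v (List.isChain_iff_forall_rel_of_append_cons_cons.1 hl h)
      simp only [Finset.mem_filter, Finset.mem_univ, true_and]
      tauto)
    (by rw [hS, ← hdeg_eq, ← hdeg_eq]; omega)
  have hA : (A ++ [p]).IsChain G.Adj := by
    have h : (A ++ [p]).IsChain (G ⊔ fromEdgeSet {s(p, q)}).Adj :=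
      List.IsChain.left_of_append (l₂ := q :: B) (by simpa using hl)
    refine h.imp_of_mem_imp fun u w hu hw huw => ?_
    have hq : q ∉ A ++ [p] := by grind
    rcases hadj u w huw with h | ⟨rfl, rfl⟩ | ⟨rfl, rfl⟩
    · exact h
    · exact (hq hw).elim
    · exact (hq hu).elim
  have hB : (q :: B).IsChain G.Adj := by
    have h : (q :: B).IsChain (G ⊔ fromEdgeSet {s(p, q)}).Adj :=
      List.IsChain.right_of_append (l₁ := A ++ [p]) (by simpa using hl)
    refine h.imp_of_mem_imp fun u w hu hw huw => ?_
    have hp : p ∉ q :: B := by grind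
    rcases hadj u w huw with h | ⟨rfl, rfl⟩ | ⟨rfl, rfl⟩
    · exact h
    · exact (hp hu).elim
    · exact (hp hw).elim
  exact List.exists_perm_isChain_of_crossing (fun h => G.adj_symm h) (fun _ h => h.ne rfl) hL hA hB
    (by simpa using hc) (by simpa using hv)

end SimpleGraph

theorem stmt4 {V : Type*} [Fintype V] [DecidableEq V] (n : ℕ)
    (G : SimpleGraph V) (X : Finset V)
    (hbip : IsBalancedBipartition G X n)
    (x y : V) (hx : x ∈ X) (hy : y ∈ Xᶜ) (hxy : ¬ G.Adj x y)
    (hdeg : n + 2 ≤ deg G x + deg G y) :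
    WeaklyHamiltonConnected G X ↔
      WeaklyHamiltonConnected (G ⊔ SimpleGraph.fromEdgeSet {s(x, y)}) X := by
  have hy' : y ∉ X := Finset.mem_compl.1 hy
  constructor
  · intro h a ha b hb
    obtain ⟨w, hw⟩ := h a ha b hb
    exact ⟨w.mapLe le_sup_left, fun v => by simpa using hw v⟩
  · intro h a ha b hb
    obtain ⟨w, hw⟩ := h a ha b hb
    suffices ∃ l : List V, l.Perm w.support ∧ l.IsChain G.Adj ∧
        l.head? = w.support.head? ∧ l.getLast? = w.support.getLast? by
      obtain ⟨l, hperm, hl, hhead, hlast⟩ := this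
      refine exists_isHamiltonian_of_isChain hl ?_ ?_ fun v => by rw [hperm.count_eq, hw v]
      · rw [hhead, List.head?_eq_some_head w.support_ne_nil, w.head_support]
      · rw [hlast, List.getLast?_eq_some_getLast w.support_ne_nil, w.getLast_support]
    have hchain := w.isChain_adj_support
    have hcount : ∀ v, w.support.count v = 1 := hw
    generalize w.support = l at hchain hcount ⊢
    by_cases hc : l.IsChain G.Adj
    · exact ⟨l, .refl l, hc, rfl, rfl⟩
    rw [List.isChain_iff_forall_rel_of_append_cons_cons] at hc
    push Not at hc
    obtain ⟨p, q, A, B, rfl, hpq⟩ := hc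
    have hpq' := List.isChain_iff_forall_rel_of_append_cons_cons.1 hchain rfl
    simp only [sup_adj, hpq, fromEdgeSet_adj, Set.mem_singleton_iff, Sym2.eq_iff,
      false_or] at hpq'
    rcases hpq'.1 with ⟨rfl, rfl⟩ | ⟨rfl, rfl⟩
    · exact exists_isChain_of_isChain_sup_edge hbip (by tauto) hdeg hchain hcount
    · rw [Sym2.eq_swap] at hchain
      exact exists_isChain_of_isChain_sup_edge hbip (by tauto) (by omega) hchain hcount
end

section
/- Let G be a balanced bipartite graph with parts X and Y, |X| = |Y| = n, and let k be an integer with 2 ≤ k ≤ (n+1)/2 such that every vertex of G has degree at least k. If e(G) > max{ n(n−t+1) + t(t+1) : t an integer with k ≤ t ≤ (n+1)/2 }, then G is weakly Hamilton-connected. -/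
open SimpleGraph

/-- The list `l` enumerates the vertices of a Hamilton path of `G` from `u` to `v`. -/
structure IsHamiltonList {V : Type*} (G : SimpleGraph V) (u v : V) (l : List V) : Prop where
  nodup : l.Nodup
  mem : ∀ w, w ∈ l
  chain : l.IsChain G.Adj
  head : l.head? = some u
  last : l.getLast? = some v

theorem exists_walk_support_eq {V : Type*} (G : SimpleGraph V) (v : V) (l : List V) :
    ∀ u, l.IsChain G.Adj → l.head? = some u → l.getLast? = some v →
      ∃ p : G.Walk u v, p.support = l := by
  induction l with
  | nil => simp
  | cons a l ih =>
    intro u hc hh hl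
    obtain rfl : a = u := by simpa using hh
    cases l with
    | nil =>
      obtain rfl : a = v := by simpa using hl
      exact ⟨.nil, rfl⟩
    | cons b l =>
      rw [List.isChain_cons_cons] at hc
      obtain ⟨p, hp⟩ := ih b hc.2 rfl (by simpa using hl)
      exact ⟨.cons hc.1 p, by simp [hp]⟩

theorem IsHamiltonList.exists_walk {V : Type*} [DecidableEq V] {G : SimpleGraph V} {u v : V}
    {l : List V} (h : IsHamiltonList G u v l) : ∃ p : G.Walk u v, p.IsHamiltonian := by
  obtain ⟨p, hp⟩ := exists_walk_support_eq G v l u h.chain h.head h.last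
  refine ⟨p, fun w => ?_⟩
  rw [hp]
  exact List.count_eq_one_of_mem h.nodup (h.mem w)

/-- Reversing a segment of a broken path to mend the break between `w` and `z`. -/
theorem exists_isHamiltonList_of_crossing {V : Type*} {G : SimpleGraph V} {u v w z a b : V}
    {l₁ l₂ m₁ m₂ : List V} (h : l₁ ++ w :: z :: l₂ = m₁ ++ a :: b :: m₂)
    (hn : (l₁ ++ w :: z :: l₂).Nodup) (hm : ∀ c, c ∈ l₁ ++ w :: z :: l₂)
    (hA : (l₁ ++ [w]).IsChain G.Adj) (hB : (z :: l₂).IsChain G.Adj)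
    (hh : (l₁ ++ w :: z :: l₂).head? = some u) (hl : (l₁ ++ w :: z :: l₂).getLast? = some v)
    (hwa : G.Adj w a) (hzb : G.Adj z b) : ∃ l, IsHamiltonList G u v l := by
  have h' : (l₁ ++ [w]) ++ (z :: l₂) = (m₁ ++ [a]) ++ (b :: m₂) := by simpa using h
  suffices ∃ l : List V, l.Perm (l₁ ++ w :: z :: l₂) ∧ l.IsChain G.Adj ∧ l.head? = some u ∧
      l.getLast? = some v by
    obtain ⟨l, hp, hc, h1, h2⟩ := this
    exact ⟨l, hp.nodup_iff.2 hn, fun c => hp.mem_iff.2 (hm c), hc, h1, h2⟩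
  rcases List.append_eq_append_iff.1 h' with ⟨c, h1, h2⟩ | ⟨c, h1, h2⟩
  · rcases List.eq_nil_or_concat' c with rfl | ⟨c, a', rfl⟩
    · have : a = w := by simp at h1; exact h1.2
      exact absurd (this ▸ hwa) (G.irrefl)
    obtain rfl : a = a' := by
      have := congrArg List.getLast? h1
      rw [List.getLast?_concat, ← List.append_assoc, List.getLast?_concat] at this
      exact Option.some.inj this
    rw [h2] at hB
    have hz : (c ++ [a]).head? = some z := by
      have := congrArg List.head? h2
      simpa using this.symm
    refine ⟨(l₁ ++ [w]) ++ ((c ++ [a]).reverse ++ b :: m₂), ?_, ?_, ?_, ?_⟩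
    · rw [show l₁ ++ w :: z :: l₂ = (l₁ ++ [w]) ++ ((c ++ [a]) ++ b :: m₂) by rw [← h2]; simp]
      exact ((List.reverse_perm _).append_right _).append_left _
    · rw [List.isChain_append] at hB
      refine List.isChain_append.2 ⟨hA, List.isChain_append.2 ⟨by
        simpa only [List.isChain_reverse, G.adj_comm] using hB.1, hB.2.1, ?_⟩, ?_⟩
      · rw [List.getLast?_reverse, hz]; simpa using hzb
      · simpa using hwa
    · rw [← hh]; simp [List.head?_append]
    · rw [← hl, h]; simp [List.getLast?_append, List.getLast?_cons]
  · rcases List.eq_nil_or_concat' c with rfl | ⟨c, w', rfl⟩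
    · have : a = w := by simp at h1; exact h1.2.symm
      exact absurd (this ▸ hwa) (G.irrefl)
    obtain rfl : w = w' := by
      have := congrArg List.getLast? h1
      rw [List.getLast?_concat, ← List.append_assoc, List.getLast?_concat] at this
      exact Option.some.inj this
    rw [h1] at hA
    have hb : (c ++ [w]).head? = some b := by
      have := congrArg List.head? h2
      simpa using this.symm
    refine ⟨(m₁ ++ [a]) ++ ((c ++ [w]).reverse ++ z :: l₂), ?_, ?_, ?_, ?_⟩
    · rw [show l₁ ++ w :: z :: l₂ = (m₁ ++ [a]) ++ ((c ++ [w]) ++ z :: l₂) by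
        rw [← List.append_assoc, ← h1]; simp]
      exact ((List.reverse_perm _).append_right _).append_left _
    · rw [List.isChain_append] at hA
      refine List.isChain_append.2 ⟨hA.1, List.isChain_append.2 ⟨by
        simpa only [List.isChain_reverse, G.adj_comm] using hA.2.1, hB, ?_⟩, ?_⟩
      · rw [List.getLast?_reverse, hb]; simpa using hzb.symm
      · simpa using hwa.symm
    · rw [← hh, h]; simp [List.head?_append]
    · rw [← hl]; simp [List.getLast?_append, List.getLast?_cons]

/-- In a list without repetitions whose steps change sides, `w` and `z` of large total degree have
crossing neighbours. -/
theorem exists_crossing {V : Type*} [Fintype V] {G : SimpleGraph V}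
    {W Z : Finset V} {w z v : V} {l : List V}
    (hn : l.Nodup) (hm : ∀ c, c ∈ l) (hl : l.getLast? = some v)
    (hside : ∀ m₁ a b m₂, l = m₁ ++ a :: b :: m₂ → a ∈ Z → b ∈ W)
    (hwZ : ∀ a, G.Adj w a → a ∈ Z) (hzW : ∀ a, G.Adj z a → a ∈ W)
    (hd : W.card + 2 ≤ deg G w + deg G z) :
    ∃ m₁ a b m₂, l = m₁ ++ a :: b :: m₂ ∧ G.Adj w a ∧ G.Adj z b := by
  classical
  by_contra! hcon
  have hsucc : ∀ a, a ≠ v → ∃ b m₁ m₂, l = m₁ ++ a :: b :: m₂ := by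
    intro a ha
    obtain ⟨m₁, m₂, rfl⟩ := List.append_of_mem (hm a)
    cases m₂ with
    | nil => simp at hl; exact absurd hl ha
    | cons b m₂ => exact ⟨b, m₁, m₂, rfl⟩
  choose! s m₁ m₂ hs using hsucc
  have hcard : ((G.neighborFinset w).erase v).card ≤ (W \ G.neighborFinset z).card := by
    apply Finset.card_le_card_of_injOn s
    · intro a ha
      simp only [Finset.coe_erase, coe_neighborFinset, Set.mem_sdiff, mem_neighborSet,
        Set.mem_singleton_iff] at ha
      simp only [Finset.coe_sdiff, coe_neighborFinset, Set.mem_sdiff, Finset.mem_coe,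
        mem_neighborSet]
      exact ⟨hside _ _ _ _ (hs a ha.2) (hwZ a ha.1), hcon _ _ _ _ (hs a ha.2) ha.1⟩
    · intro a ha a' ha' hab
      simp only [Finset.coe_erase, coe_neighborFinset, Set.mem_sdiff, mem_neighborSet,
        Set.mem_singleton_iff] at ha ha'
      have e1 := hs a ha.2
      have e2 := hs a' ha'.2
      rw [← hab] at e2
      have i1 : l[(m₁ a).length + 1]? = some (s a) := by
        conv_lhs => rw [e1]
        simp
      have i2 : l[(m₁ a').length + 1]? = some (s a) := by
        conv_lhs => rw [e2]
        simp
      have hlt : (m₁ a).length + 1 < l.length := (List.getElem?_eq_some_iff.1 i1).1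
      have hi := (List.getElem?_inj hlt hn).1 (i1.trans i2.symm)
      have j1 : l[(m₁ a).length]? = some a := by
        conv_lhs => rw [e1]
        simp
      have j2 : l[(m₁ a').length]? = some a' := by
        conv_lhs => rw [e2]
        simp
      rw [Nat.succ_injective hi, j2] at j1
      exact (Option.some.inj j1).symm
  have dw : (G.neighborFinset w).card = deg G w := by
    rw [deg, ← Set.ncard_coe_finset, coe_neighborFinset]; rfl
  have dz : (G.neighborFinset z).card = deg G z := by
    rw [deg, ← Set.ncard_coe_finset, coe_neighborFinset]; rfl
  have hsub : G.neighborFinset z ⊆ W := fun a ha => hzW a (by simpa using ha)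
  rw [Finset.card_sdiff_of_subset hsub, dz] at hcard
  have := Finset.pred_card_le_card_erase (s := G.neighborFinset w) (a := v)
  have := Finset.card_le_card hsub
  omega

theorem exists_isHamiltonList_of_break {V : Type*} [Fintype V] {G : SimpleGraph V}
    {W Z : Finset V} {u v w z : V} {l₁ l₂ : List V}
    (hl : IsHamiltonList (G ⊔ edge w z) u v (l₁ ++ w :: z :: l₂))
    (hside : ∀ a b, (G ⊔ edge w z).Adj a b → a ∈ Z → b ∈ W)
    (hwZ : ∀ a, G.Adj w a → a ∈ Z) (hzW : ∀ a, G.Adj z a → a ∈ W)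
    (hd : W.card + 2 ≤ deg G w + deg G z) : ∃ l, IsHamiltonList G u v l := by
  obtain ⟨m₁, a, b, m₂, h, hwa, hzb⟩ := exists_crossing hl.nodup hl.mem hl.last
    (fun m₁ a b m₂ h => hside a b (by
      have := hl.chain
      rw [h, List.isChain_append, List.isChain_cons_cons] at this
      exact this.2.1.1)) hwZ hzW hd
  have hc : ((l₁ ++ [w]) ++ (z :: l₂)).IsChain (G ⊔ edge w z).Adj := by simpa using hl.chain
  have hn : ((l₁ ++ [w]) ++ (z :: l₂)).Nodup := by simpa using hl.nodup
  rw [List.isChain_append] at hc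
  rw [List.nodup_append'] at hn
  refine exists_isHamiltonList_of_crossing h hl.nodup hl.mem ?_ ?_ hl.head hl.last hwa hzb
  · refine hc.1.imp_of_mem_imp fun x y hx hy hxy => ?_
    rcases hxy with hxy | hxy
    · exact hxy
    · rw [edge_adj] at hxy
      have : z ∉ l₁ ++ [w] := fun hz => hn.2.2 hz (by simp)
      rcases hxy.1 with ⟨rfl, rfl⟩ | ⟨rfl, rfl⟩ <;> contradiction
  · refine hc.2.1.imp_of_mem_imp fun x y hx hy hxy => ?_
    rcases hxy with hxy | hxy
    · exact hxy
    · rw [edge_adj] at hxy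
      have : w ∉ z :: l₂ := fun hz => hn.2.2 (by simp) hz
      rcases hxy.1 with ⟨rfl, rfl⟩ | ⟨rfl, rfl⟩ <;> contradiction

theorem IsBalancedBipartition.sup_edge {V : Type*} [Fintype V] [DecidableEq V]
    {G : SimpleGraph V} {X : Finset V} {n : ℕ} (h : IsBalancedBipartition G X n) {w z : V}
    (hw : w ∈ X) (hz : z ∉ X) : IsBalancedBipartition (G ⊔ edge w z) X n := by
  refine ⟨h.1, h.2.1, fun a b hab => ?_⟩
  rcases hab with hab | hab
  · exact h.2.2 a b hab
  · rw [edge_adj] at hab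
    rcases hab.1 with ⟨rfl, rfl⟩ | ⟨rfl, rfl⟩ <;> tauto

/-- The Bondy–Chvátal closure step for Hamilton paths joining the two sides. -/
theorem exists_isHamiltonList_of_sup_edge {V : Type*} [Fintype V] [DecidableEq V]
    {G : SimpleGraph V} {X : Finset V} {n : ℕ} (hbip : IsBalancedBipartition G X n) {u v w z : V}
    (hw : w ∈ X) (hz : z ∉ X) (hd : n + 2 ≤ deg G w + deg G z) {l : List V}
    (hl : IsHamiltonList (G ⊔ edge w z) u v l) : ∃ l, IsHamiltonList G u v l := by
  by_cases hc : l.IsChain G.Adj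
  · exact ⟨l, hl.nodup, hl.mem, hc, hl.head, hl.last⟩
  have hbip' := hbip.sup_edge hw hz
  have hw' := fun a (h : G.Adj w a) => hbip.2.2 w a h
  have hz' := fun a (h : G.Adj z a) => hbip.2.2 z a h
  have : ∃ m₁ a b m₂, l = m₁ ++ a :: b :: m₂ ∧ ¬ G.Adj a b := by
    by_contra! hcon
    exact hc (List.isChain_iff_forall_rel_of_append_cons_cons.2 fun _ _ _ _ h => hcon _ _ _ _ h)
  obtain ⟨m₁, a, b, m₂, rfl, hab⟩ := this
  have hadj := hl.chain
  rw [List.isChain_append, List.isChain_cons_cons] at hadj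
  rcases hadj.2.1.1 with h | h
  · exact absurd h hab
  rw [edge_adj] at h
  rcases h.1 with ⟨rfl, rfl⟩ | ⟨rfl, rfl⟩
  · refine exists_isHamiltonList_of_break (W := X) (Z := Xᶜ) hl (fun a b hab ha => ?_)
      (fun a ha => ?_) (fun a ha => ?_) (by rw [hbip.1]; exact hd)
    · have := hbip'.2.2 a b hab
      simp at ha; tauto
    · have := hw' a ha
      simp; tauto
    · have := hz' a ha
      tauto
  · rw [edge_comm] at hl hbip'
    refine exists_isHamiltonList_of_break (W := Xᶜ) (Z := X) hl (fun a b hab ha => ?_)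
      (fun a ha => ?_) (fun a ha => ?_) (by rw [hbip.2.1]; omega)
    · have := hbip'.2.2 a b hab
      simp; tauto
    · have := hz' a ha
      tauto
    · have := hw' a ha
      simp; tauto

theorem exists_alternating_list {V : Type*} [DecidableEq V] {G : SimpleGraph V} (m : ℕ) :
    ∀ S T : Finset V, Disjoint S T → S.card = m + 1 → T.card = m + 1 →
      (∀ x ∈ S, ∀ y ∈ T, G.Adj x y) → ∀ x ∈ S, ∀ y ∈ T,
      ∃ l : List V, l.Nodup ∧ (∀ w, w ∈ l ↔ w ∈ S ∪ T) ∧ l.IsChain G.Adj ∧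
        l.head? = some x ∧ l.getLast? = some y := by
  induction m with
  | zero =>
    intro S T hST hS hT hadj x hx y hy
    obtain ⟨x', rfl⟩ := Finset.card_eq_one.1 hS
    obtain ⟨y', rfl⟩ := Finset.card_eq_one.1 hT
    obtain rfl : x = x' := by simpa using hx
    obtain rfl : y = y' := by simpa using hy
    have := hadj x hx y hy
    exact ⟨[x, y], by simpa using this.ne, by simp, by simpa using this, rfl, rfl⟩
  | succ m ih =>
    intro S T hST hS hT hadj x hx y hy
    obtain ⟨x', hx', hxx⟩ := Finset.exists_mem_ne (s := S) (by omega) x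
    obtain ⟨y', hy', hyy⟩ := Finset.exists_mem_ne (s := T) (by omega) y
    obtain ⟨l, hn, hm, hc, hh, hl⟩ := ih (S.erase x) (T.erase y')
      (hST.mono (Finset.erase_subset _ _) (Finset.erase_subset _ _))
      (by rw [Finset.card_erase_of_mem hx]; omega) (by rw [Finset.card_erase_of_mem hy']; omega)
      (fun a ha b hb => hadj a (Finset.mem_of_mem_erase ha) b (Finset.mem_of_mem_erase hb))
      x' (Finset.mem_erase.2 ⟨hxx, hx'⟩) y (Finset.mem_erase.2 ⟨hyy.symm, hy⟩)
    have hxT : x ∉ T := Finset.disjoint_left.1 hST hx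
    have hyS : y' ∉ S := Finset.disjoint_right.1 hST hy'
    have hxy := hadj x hx y' hy'
    refine ⟨x :: y' :: l, ?_, fun w => ?_, ?_, rfl, ?_⟩
    · simp [hn, hm, hxT, hyS, hxy.ne]
    · simp only [List.mem_cons, hm, Finset.mem_union, Finset.mem_erase]
      by_cases h1 : w = x
      · simp [h1, hx]
      by_cases h2 : w = y'
      · simp [h2, hy']
      simp [h1, h2]
    · rw [List.isChain_cons_cons, List.isChain_cons]
      refine ⟨hxy, ?_, hc⟩
      rw [hh]
      simpa using (hadj x' hx' y' hy').symm
    · simp [List.getLast?_cons, hl]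

theorem IsBalancedBipartition.compl {V : Type*} [Fintype V] [DecidableEq V]
    {G : SimpleGraph V} {X : Finset V} {n : ℕ} (h : IsBalancedBipartition G X n) :
    IsBalancedBipartition G Xᶜ n := by
  refine ⟨h.2.1, by simpa using h.1, fun u v huv => ?_⟩
  have := h.2.2 u v huv
  simp; tauto

theorem IsBalancedBipartition.numEdges_eq {V : Type*} [Fintype V] [DecidableEq V]
    {G : SimpleGraph V} {X : Finset V} {n : ℕ} (h : IsBalancedBipartition G X n) :
    numEdges G = ∑ y ∈ Xᶜ, deg G y := by
  classical
  have hb : G.IsBipartiteWith (Xᶜ : Finset V) (X : Finset V) := by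
    refine ⟨?_, fun a b hab => ?_⟩
    · exact Finset.disjoint_coe.2 disjoint_compl_left
    · have := h.2.2 a b hab
      simp; tauto
  rw [numEdges, ← coe_edgeFinset, Set.ncard_coe_finset,
    ← isBipartiteWith_sum_degrees_eq_card_edges hb]
  refine Finset.sum_congr rfl fun y _ => ?_
  rw [deg, ← card_neighborFinset_eq_degree, ← Set.ncard_coe_finset, coe_neighborFinset]
  rfl

theorem IsBalancedBipartition.deg_le {V : Type*} [Fintype V] [DecidableEq V]
    {G : SimpleGraph V} {X : Finset V} {n : ℕ} (h : IsBalancedBipartition G X n) {y : V}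
    (hy : y ∉ X) : deg G y ≤ n := by
  rw [← h.1, ← Set.ncard_coe_finset]
  refine Set.ncard_le_ncard (fun a ha => ?_)
  have := h.2.2 y a ha
  simp; tauto

/-- If the degree sum of `x` with each non-neighbour on the other side is at most `n + 1`, then
`G` has few edges. -/
theorem IsBalancedBipartition.numEdges_le {V : Type*} [Fintype V] [DecidableEq V]
    {G : SimpleGraph V} {X : Finset V} {n : ℕ} (h : IsBalancedBipartition G X n) {x : V}
    (hx : x ∈ X) (hd : ∀ y ∉ X, ¬ G.Adj x y → deg G x + deg G y ≤ n + 1) :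
    numEdges G ≤ (n - deg G x) * (n - deg G x + 1) + deg G x * n := by
  classical
  have hN : (Xᶜ.filter (G.Adj x)).card = deg G x := by
    rw [deg, ← Set.ncard_coe_finset]
    congr 1
    ext y
    have := h.2.2 x y
    simp; tauto
  have hN' : (Xᶜ.filter (fun y => ¬ G.Adj x y)).card = n - deg G x := by
    have := Finset.card_filter_add_card_filter_not (s := Xᶜ) (G.Adj x)
    rw [hN, h.2.1] at this
    omega
  have hle : deg G x ≤ n := by simpa using h.compl.deg_le (y := x) (by simpa using hx)
  rw [h.numEdges_eq, ← Finset.sum_filter_add_sum_filter_not _ (G.Adj x), add_comm]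
  refine add_le_add ?_ ?_
  · rw [← hN', ← smul_eq_mul]
    refine Finset.sum_le_card_nsmul _ _ _ fun y hy => ?_
    simp only [Finset.mem_filter, Finset.mem_compl] at hy
    have := hd y hy.1 hy.2
    omega
  · conv_rhs => rw [← hN, ← smul_eq_mul]
    refine Finset.sum_le_card_nsmul _ _ _ fun y hy => ?_
    simp only [Finset.mem_filter, Finset.mem_compl] at hy
    exact h.deg_le hy.1

theorem IsBalancedBipartition.lt_of_two_mul_deg_le {V : Type*} [Fintype V] [DecidableEq V]
    {G : SimpleGraph V} {X : Finset V} {n k : ℕ} (h : IsBalancedBipartition G X n)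
    (hδ : ∀ v : V, k ≤ deg G v)
    (he : ∀ t : ℕ, k ≤ t → 2 * t ≤ n + 1 → n * (n - t + 1) + t * (t + 1) < numEdges G)
    {x : V} (hx : x ∈ X) (hd : ∀ y ∉ X, ¬ G.Adj x y → deg G x + deg G y ≤ n + 1) :
    n + 1 < 2 * deg G x := by
  by_contra! hlt
  have h1 := he _ (hδ x) hlt
  have h2 := h.numEdges_le hx hd
  have hle : deg G x ≤ n := by simpa using h.compl.deg_le (y := x) (by simpa using hx)
  obtain ⟨m, hm⟩ := Nat.exists_eq_add_of_le hle
  generalize deg G x = t at *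
  subst hm
  rw [Nat.add_sub_cancel_left] at h1 h2
  nlinarith

theorem exists_isHamiltonList {V : Type*} [Fintype V] [DecidableEq V] (n k : ℕ)
    (G : SimpleGraph V) (X : Finset V)
    (hbip : IsBalancedBipartition G X n)
    (hδ : ∀ v : V, k ≤ deg G v)
    (he : ∀ t : ℕ, k ≤ t → 2 * t ≤ n + 1 → n * (n - t + 1) + t * (t + 1) < numEdges G)
    {x y : V} (hx : x ∈ X) (hy : y ∉ X) : ∃ l, IsHamiltonList G x y l := by
  induction G using WellFoundedGT.induction with
  | ind G ih =>
  by_cases hcl : ∃ w ∈ X, ∃ z ∉ X, ¬ G.Adj w z ∧ n + 2 ≤ deg G w + deg G z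
  · obtain ⟨w, hw, z, hz, hwz, hd⟩ := hcl
    have hne : w ≠ z := fun h => hz (h ▸ hw)
    obtain ⟨l, hl⟩ := ih (G ⊔ edge w z) (G.lt_sup_edge _ _ hne hwz) (hbip.sup_edge hw hz)
      (fun v => (hδ v).trans (Set.ncard_le_ncard fun a ha => Or.inl ha))
      (fun t h1 h2 => (he t h1 h2).trans_le
        (Set.ncard_le_ncard (edgeSet_mono le_sup_left)))
    exact exists_isHamiltonList_of_sup_edge hbip hw hz hd hl
  push Not at hcl
  have hadj : ∀ w ∈ X, ∀ z ∈ Xᶜ, G.Adj w z := by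
    intro w hw z hz
    rw [Finset.mem_compl] at hz
    by_contra hwz
    have h1 := hbip.lt_of_two_mul_deg_le hδ he hw
      (fun z hz hwz => Nat.lt_succ_iff.1 (hcl w hw z hz hwz))
    have h2 := hbip.compl.lt_of_two_mul_deg_le hδ he (x := z) (by simpa using hz)
      (fun w hw hwz => by
        rw [add_comm]
        exact Nat.lt_succ_iff.1 (hcl w (by simpa using hw) z hz (fun h => hwz h.symm)))
    have := hcl w hw z hz hwz
    omega
  obtain ⟨m, rfl⟩ : ∃ m, n = m + 1 :=
    Nat.exists_eq_succ_of_ne_zero (hbip.1 ▸ Finset.card_ne_zero_of_mem hx)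
  obtain ⟨l, hn, hm, hc, hh, hl⟩ := exists_alternating_list m X Xᶜ disjoint_compl_right
    hbip.1 hbip.2.1 hadj x hx y (by simpa using hy)
  exact ⟨l, hn, fun w => by simp [hm], hc, hh, hl⟩

theorem stmt7 {V : Type*} [Fintype V] [DecidableEq V] (n k : ℕ)
    (G : SimpleGraph V) (X : Finset V)
    (hbip : IsBalancedBipartition G X n)
    (hk2 : 2 ≤ k) (hk : 2 * k ≤ n + 1)
    (hδ : ∀ v : V, k ≤ deg G v)
    (he : ∀ t : ℕ, k ≤ t → 2 * t ≤ n + 1 → n * (n - t + 1) + t * (t + 1) < numEdges G) :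
    WeaklyHamiltonConnected G X := by
  intro x hx y hy
  obtain ⟨l, hl⟩ := exists_isHamiltonList n k G X hbip hδ he hx (by simpa using hy)
  exact hl.exists_walk
end

section
/- Let k ≥ 1 and n ≥ 2k, and let G be a balanced bipartite graph of order 2n with parts X and Y, |X| = |Y| = n, such that d(x) + d(y) ≤ n + 1 for every pair of nonadjacent vertices x ∈ X, y ∈ Y (i.e., G equals its B_{n+2}-closure). If e(G) > n(n−k) + k(k+1), then G contains a complete bipartite subgraph of order at least 2n − k + 1; that is, there exist sets S ⊆ X and T ⊆ Y with |S| + |T| ≥ 2n − k + 1 such that every vertex of S is adjacent to every vertex of T. -/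
open SimpleGraph

/-- If related elements have at least `n - 1` partners in total and `r` has few pairs, then no
element has a mid-sized number `δ` of partners: those would account for `δ * (n - 1 - δ)` pairs. -/
theorem card_bipartiteAbove_lt_or_le {α β : Type*} (X : Finset α) (Y : Finset β)
    (r : α → β → Prop) [∀ a b, Decidable (r a b)] {n k : ℕ}
    (hclosed : ∀ x ∈ X, ∀ y ∈ Y, r x y →
      n ≤ (Y.bipartiteAbove r x).card + (X.bipartiteBelow r y).card + 1)
    (hm : ∑ y ∈ Y, (X.bipartiteBelow r y).card + k * (k + 1) < n * k)
    {x : α} (hx : x ∈ X) :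
    (Y.bipartiteAbove r x).card < k ∨ n ≤ (Y.bipartiteAbove r x).card + k := by
  by_contra! h
  obtain ⟨h1, h2⟩ := h
  set D := Y.bipartiteAbove r x with hD
  have hsum : D.card * (n - 1 - D.card) ≤ ∑ y ∈ D, (X.bipartiteBelow r y).card := by
    rw [← smul_eq_mul]
    refine Finset.card_nsmul_le_sum _ _ _ fun y hy => ?_
    have hy' := (Finset.mem_bipartiteAbove r).1 hy
    have := hclosed x hx y hy'.1 hy'.2
    rw [← hD] at this
    omega
  have hle : ∑ y ∈ D, (X.bipartiteBelow r y).card ≤ ∑ y ∈ Y, (X.bipartiteBelow r y).card :=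
    Finset.sum_le_sum_of_subset (Finset.filter_subset _ _)
  obtain ⟨a, ha⟩ := Nat.exists_eq_add_of_le h1
  obtain ⟨b, hb⟩ := Nat.exists_eq_add_of_lt h2
  have hn : n - 1 - D.card = k + b := by omega
  rw [hn, ha] at hsum
  rw [ha] at hb
  subst hb
  nlinarith [Nat.zero_le (a * b)]

/-- Pairs meeting `P` or `Q`, counted with the overlap `P × Q` at most once too often. -/
theorem sum_card_bipartite_add_le {α β : Type*} [DecidableEq α] {X P : Finset α} {Y Q : Finset β}
    (hP : P ⊆ X) (hQ : Q ⊆ Y) (r : α → β → Prop) [∀ a b, Decidable (r a b)] :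
    ∑ x ∈ P, (Y.bipartiteAbove r x).card + ∑ y ∈ Q, (X.bipartiteBelow r y).card ≤
      ∑ x ∈ X, (Y.bipartiteAbove r x).card + P.card * Q.card := by
  rw [← Finset.sum_card_bipartiteAbove_eq_sum_card_bipartiteBelow, ← Finset.sum_sdiff hP,
    ← Finset.sum_sdiff hP (f := fun x => (Y.bipartiteAbove r x).card)]
  have h1 : ∑ x ∈ P, (Q.bipartiteAbove r x).card ≤ P.card * Q.card := by
    rw [← smul_eq_mul]
    exact Finset.sum_le_card_nsmul _ _ _ fun x _ => Finset.card_le_card (Finset.filter_subset _ _)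
  have h2 : ∑ x ∈ X \ P, (Q.bipartiteAbove r x).card ≤
      ∑ x ∈ X \ P, (Y.bipartiteAbove r x).card :=
    Finset.sum_le_sum fun x _ => Finset.card_le_card (Finset.filter_subset_filter _ hQ)
  omega

/-- If no pair of `(X \ P) × (Y \ Q)` is related and related elements have at least `n - 1`
partners in total, then an element of `P` with more than `|Q|` partners has at least
`n - 1 - |P|` of them. -/
theorem le_card_bipartiteAbove_of_mem {α β : Type*} [DecidableEq α] [DecidableEq β]
    {X P : Finset α} {Y Q : Finset β}
    (hP : P ⊆ X) (r : α → β → Prop) [∀ a b, Decidable (r a b)] {n : ℕ}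
    (hclosed : ∀ x ∈ X, ∀ y ∈ Y, r x y →
      n ≤ (Y.bipartiteAbove r x).card + (X.bipartiteBelow r y).card + 1)
    (hcomplete : ∀ x ∈ X \ P, ∀ y ∈ Y \ Q, ¬ r x y)
    {x : α} (hx : x ∈ P) (hlarge : Q.card < (Y.bipartiteAbove r x).card) :
    n ≤ (Y.bipartiteAbove r x).card + P.card + 1 := by
  obtain ⟨y, hy, hyQ⟩ := Finset.exists_mem_notMem_of_card_lt_card hlarge
  obtain ⟨hyY, hxy⟩ := (Finset.mem_bipartiteAbove r).1 hy
  have h := hclosed x (hP hx) y hyY hxy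
  have hsub : X.bipartiteBelow r y ⊆ P := by
    intro z hz
    obtain ⟨hzX, hzy⟩ := (Finset.mem_bipartiteBelow r).1 hz
    by_contra hzP
    exact hcomplete z (by simp [hzX, hzP]) y (by simp [hyY, hyQ]) hzy
  have := Finset.card_le_card hsub
  omega

/-- A sparse relation in which related elements have many partners in total is empty on the
product of two large subsets. -/
theorem exists_large_unrelated {α β : Type*} [DecidableEq α] [DecidableEq β]
    (X : Finset α) (Y : Finset β) (r : α → β → Prop) [∀ a b, Decidable (r a b)] {n k : ℕ}
    (hn : 2 * k ≤ n) (hX : X.card = n) (hY : Y.card = n)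
    (hclosed : ∀ x ∈ X, ∀ y ∈ Y, r x y →
      n ≤ (Y.bipartiteAbove r x).card + (X.bipartiteBelow r y).card + 1)
    (hm : ∑ x ∈ X, (Y.bipartiteAbove r x).card + k * (k + 1) < n * k) :
    ∃ S ⊆ X, ∃ T ⊆ Y, 2 * n + 1 ≤ S.card + T.card + k ∧ ∀ s ∈ S, ∀ t ∈ T, ¬ r s t := by
  have hswap := Finset.sum_card_bipartiteAbove_eq_sum_card_bipartiteBelow (s := X) (t := Y) r
  have hclosed' : ∀ y ∈ Y, ∀ x ∈ X, Function.swap r y x →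
      n ≤ (X.bipartiteAbove (Function.swap r) y).card +
        (Y.bipartiteBelow (Function.swap r) x).card + 1 := by
    intro y hy x hx h
    have := hclosed x hx y hy h
    simp only [Finset.bipartiteAbove_swap, Finset.bipartiteBelow_swap]
    omega
  have hgapX : ∀ x ∈ X, (Y.bipartiteAbove r x).card < k ∨ n ≤ (Y.bipartiteAbove r x).card + k :=
    fun x hx => card_bipartiteAbove_lt_or_le X Y r hclosed (hswap ▸ hm) hx
  have hgapY : ∀ y ∈ Y, (X.bipartiteBelow r y).card < k ∨ n ≤ (X.bipartiteBelow r y).card + k :=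
    fun y hy => card_bipartiteAbove_lt_or_le Y X (Function.swap r) hclosed' hm hy
  set P := X.filter fun x => n ≤ (Y.bipartiteAbove r x).card + k with hPdef
  set Q := Y.filter fun y => n ≤ (X.bipartiteBelow r y).card + k with hQdef
  have hP : P ⊆ X := Finset.filter_subset _ _
  have hQ : Q ⊆ Y := Finset.filter_subset _ _
  have hcomplete : ∀ x ∈ X \ P, ∀ y ∈ Y \ Q, ¬ r x y := by
    intro x hx y hy hxy
    simp only [hPdef, hQdef, Finset.mem_sdiff, Finset.mem_filter, not_and] at hx hy
    have h1 := hgapX x hx.1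
    have h2 := hgapY y hy.1
    have h3 := hx.2 hx.1
    have h4 := hy.2 hy.1
    have := hclosed x hx.1 y hy.1 hxy
    omega
  refine ⟨X \ P, Finset.sdiff_subset, Y \ Q, Finset.sdiff_subset, ?_, hcomplete⟩
  rw [Finset.card_sdiff_of_subset hP, Finset.card_sdiff_of_subset hQ, hX, hY]
  have hPn := Finset.card_le_card hP
  have hQn := Finset.card_le_card hQ
  rw [hX] at hPn
  rw [hY] at hQn
  by_contra! hlt
  have hpq : k ≤ P.card + Q.card := by omega
  have hkn : k * (k + 1) < n * k := by omega
  have hkn' : k + 1 < n := by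
    by_contra! h
    nlinarith [Nat.mul_le_mul_left k h]
  have hPdeg : ∀ x ∈ P, n - k ≤ (Y.bipartiteAbove r x).card := by
    intro x hx
    have := (Finset.mem_filter.1 hx).2
    omega
  have hQdeg : ∀ y ∈ Q, n - k ≤ (X.bipartiteBelow r y).card := by
    intro y hy
    have := (Finset.mem_filter.1 hy).2
    omega
  have hmul : (n - k) * k + k * k = n * k := by
    rw [← Nat.add_mul, Nat.sub_add_cancel (by omega)]
  have hPk : P.card < k := by
    by_contra! h
    have h1 := Finset.card_nsmul_le_sum _ _ _ hPdeg
    have h2 := Finset.sum_le_sum_of_subset (f := fun x => (Y.bipartiteAbove r x).card) hP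
    rw [smul_eq_mul] at h1
    nlinarith [Nat.mul_le_mul_right (n - k) h]
  have hQk : Q.card < k := by
    by_contra! h
    have h1 := Finset.card_nsmul_le_sum _ _ _ hQdeg
    have h2 := Finset.sum_le_sum_of_subset (f := fun y => (X.bipartiteBelow r y).card) hQ
    rw [smul_eq_mul] at h1
    nlinarith [Nat.mul_le_mul_right (n - k) h]
  have hPdeg' : ∀ x ∈ P, n - 1 - P.card ≤ (Y.bipartiteAbove r x).card := by
    intro x hx
    have h := hPdeg x hx
    have := le_card_bipartiteAbove_of_mem hP r hclosed hcomplete hx (by omega)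
    omega
  have hQdeg' : ∀ y ∈ Q, n - 1 - Q.card ≤ (X.bipartiteBelow r y).card := by
    intro y hy
    have h := hQdeg y hy
    have : n ≤ (X.bipartiteBelow r y).card + Q.card + 1 :=
      le_card_bipartiteAbove_of_mem hQ (Function.swap r) hclosed'
        (fun y hy x hx => hcomplete x hx y hy) hy
        (show P.card < (X.bipartiteBelow r y).card by omega)
    omega
  have hbound := sum_card_bipartite_add_le hP hQ r
  have hPsum := Finset.card_nsmul_le_sum _ _ _ hPdeg'
  have hQsum := Finset.card_nsmul_le_sum _ _ _ hQdeg'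
  rw [smul_eq_mul] at hPsum hQsum
  obtain ⟨w, hw⟩ := Nat.exists_eq_add_of_le hpq
  obtain ⟨c, hc⟩ := Nat.exists_eq_add_of_le hn
  obtain ⟨u, hu⟩ := Nat.exists_eq_add_of_lt hPk
  obtain ⟨v, hv⟩ := Nat.exists_eq_add_of_lt hQk
  generalize ∑ x ∈ X, (Y.bipartiteAbove r x).card = m at *
  have hp : P.card = w + v + 1 := by omega
  have hq : Q.card = w + u + 1 := by omega
  have hk' : k = w + u + v + 2 := by omega
  have hn1 : n - 1 - P.card = w + 2 * u + v + 2 + c := by omega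
  have hn2 : n - 1 - Q.card = w + u + 2 * v + 2 + c := by omega
  rw [hn1, hp] at hPsum
  rw [hn2, hq] at hQsum
  rw [hp, hq] at hbound
  have hn3 : n = 2 * (w + u + v + 2) + c := by omega
  rw [hn3, hk'] at hm
  nlinarith [Nat.zero_le (w * c), Nat.zero_le (u * v), Nat.zero_le (w * u), Nat.zero_le (w * v)]

theorem stmt8 {V : Type*} [Fintype V] [DecidableEq V] (n k : ℕ)
    (G : SimpleGraph V) (X : Finset V)
    (hk : 1 ≤ k) (hn : 2 * k ≤ n)
    (hbip : IsBalancedBipartition G X n)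
    (hclosed : ∀ x ∈ X, ∀ y ∈ Xᶜ, ¬ G.Adj x y → deg G x + deg G y ≤ n + 1)
    (he : n * (n - k) + k * (k + 1) < numEdges G) :
    ∃ S ⊆ X, ∃ T ⊆ Xᶜ, 2 * n - k + 1 ≤ S.card + T.card ∧
      ∀ s ∈ S, ∀ t ∈ T, G.Adj s t := by
  classical
  obtain ⟨hX, hY, hadj⟩ := hbip
  have hdegX : ∀ x ∈ X, deg G x + (Xᶜ.bipartiteAbove (fun a b => ¬ G.Adj a b) x).card = n := by
    intro x hx
    have : {u | G.Adj x u} = ↑(Xᶜ.filter fun u => G.Adj x u) := by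
      ext u
      have := hadj x u
      simp
      tauto
    rw [deg, this, Set.ncard_coe_finset, ← hY]
    exact Finset.card_filter_add_card_filter_not _
  have hdegY : ∀ y ∈ Xᶜ, deg G y + (X.bipartiteBelow (fun a b => ¬ G.Adj a b) y).card = n := by
    intro y hy
    have : {u | G.Adj y u} = ↑(X.filter fun u => G.Adj u y) := by
      ext u
      have := hadj y u
      have := Finset.mem_compl.1 hy
      simp [G.adj_comm u y]
      tauto
    rw [deg, this, Set.ncard_coe_finset, ← hX]
    exact Finset.card_filter_add_card_filter_not _
  have hedges : numEdges G ≤ ∑ x ∈ X, deg G x := by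
    have hsub : G.edgeSet ⊆ ↑(X.biUnion fun x => (Finset.univ.filter (G.Adj x)).image
        fun y => s(x, y)) := by
      intro e
      induction e with
      | _ a b =>
        intro hab
        have hab : G.Adj a b := hab
        have h := hadj a b hab
        simp only [Finset.coe_biUnion, Set.mem_iUnion, Finset.coe_image, Set.mem_image,
          Finset.mem_coe, Finset.mem_filter, Finset.mem_univ, true_and]
        by_cases ha : a ∈ X
        · exact ⟨a, ha, b, hab, rfl⟩
        · exact ⟨b, by tauto, a, hab.symm, Sym2.eq_swap⟩
    refine (Set.ncard_le_ncard hsub (Finset.finite_toSet _)).trans ?_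
    rw [Set.ncard_coe_finset]
    refine Finset.card_biUnion_le.trans (Finset.sum_le_sum fun x _ => ?_)
    refine Finset.card_image_le.trans (le_of_eq ?_)
    rw [deg, ← Set.ncard_coe_finset]
    simp
  have htotal : ∑ x ∈ X, deg G x +
      ∑ x ∈ X, (Xᶜ.bipartiteAbove (fun a b => ¬ G.Adj a b) x).card = n * n := by
    rw [← Finset.sum_add_distrib, Finset.sum_congr rfl hdegX, Finset.sum_const, hX, smul_eq_mul]
  have hnn : n * (n - k) + n * k = n * n := by
    rw [← Nat.mul_add, Nat.sub_add_cancel (by omega)]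
  obtain ⟨S, hS, T, hT, hcard, hST⟩ := exists_large_unrelated X Xᶜ (fun a b => ¬ G.Adj a b)
    (n := n) (k := k) hn hX hY
    (fun x hx y hy hxy => by
      have h1 := hdegX x hx
      have h2 := hdegY y hy
      have h3 := hclosed x hx y hy hxy
      omega)
    (by omega)
  exact ⟨S, hS, T, hT, by omega, fun s hs t ht => not_not.1 (hST s hs t ht)⟩
end

section
/- Let k ≥ 1 and n ≥ 2k, and let G be a balanced bipartite graph of order 2n with parts X and Y, |X| = |Y| = n, such that d(x) + d(y) ≤ n + 1 for every pair of nonadjacent vertices x ∈ X, y ∈ Y (i.e., G equals its B_{n+2}-closure). If e(G) > n(n−k) + k(k+1) and every vertex of G has degree at least k, then K_{n,n−k+1} ⊆ G; that is, there exist a part P ∈ {X, Y} and a set T of n − k + 1 vertices in the other part such that every vertex of T is adjacent to every vertex of P. -/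
open SimpleGraph

open Finset in
/-- In a vertex cover `(A, B)` of minimum size of a bipartite relation, the side `A` can be
matched into the complement of `B`. -/
theorem exists_injective_of_minimum_cover {α β : Type*} [Fintype β]
    [DecidableEq α] [DecidableEq β] (r : α → β → Prop) (A : Finset α) (B : Finset β)
    (hcover : ∀ a b, r a b → a ∈ A ∨ b ∈ B)
    (hmin : ∀ (A' : Finset α) (B' : Finset β), (∀ a b, r a b → a ∈ A' ∨ b ∈ B') →
      #A + #B ≤ #A' + #B') :
    ∃ f : A → β, Function.Injective f ∧ ∀ a : A, r a (f a) ∧ f a ∉ B := by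
  classical
  refine (Fintype.all_card_le_filter_rel_iff_exists_injective
    (fun (a : A) b ↦ r a b ∧ b ∉ B)).1 fun S ↦ ?_
  set N : Finset β := {b | ∃ a ∈ S, r a b ∧ b ∉ B} with hN
  have hSA : S.map (Function.Embedding.subtype _) ⊆ A := by
    intro x hx
    obtain ⟨a, -, rfl⟩ := Finset.mem_map.1 hx
    exact a.2
  have h := hmin (A \ S.map (Function.Embedding.subtype _)) (B ∪ N) fun a b hab ↦ by
    by_cases hb : b ∈ B
    · exact Or.inr (mem_union_left _ hb)
    have ha : a ∈ A := (hcover a b hab).resolve_right hb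
    by_cases haS : (⟨a, ha⟩ : A) ∈ S
    · exact Or.inr (mem_union_right _ (mem_filter.2 ⟨mem_univ b, ⟨a, ha⟩, haS, hab, hb⟩))
    · exact Or.inl (by simpa [ha] using haS)
  have h₁ := card_sdiff_add_card_eq_card hSA
  have h₂ := card_union_le B N
  rw [card_map] at h₁
  omega

open Finset in
/-- **Kőnig's theorem** for a relation between finite types: there are a vertex cover `(A, B)` and
a matching `M` of the same size, such that every vertex of the cover is related to a vertex
outside the cover. -/
theorem exists_cover_and_matching {α β : Type*} [Fintype α] [Fintype β]
    [DecidableEq α] [DecidableEq β] (r : α → β → Prop) :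
    ∃ (A : Finset α) (B : Finset β) (M : Finset (α × β)),
      (∀ a b, r a b → a ∈ A ∨ b ∈ B) ∧
      (∀ a ∈ A, ∃ b ∉ B, r a b) ∧ (∀ b ∈ B, ∃ a ∉ A, r a b) ∧
      (∀ p ∈ M, r p.1 p.2) ∧ Set.InjOn Prod.fst (M : Set (α × β)) ∧
      Set.InjOn Prod.snd (M : Set (α × β)) ∧ #M = #A + #B := by
  obtain ⟨⟨A, B⟩, hcover, hmin⟩ := Set.exists_min_image
    {C : Finset α × Finset β | ∀ a b, r a b → a ∈ C.1 ∨ b ∈ C.2} (fun C ↦ #C.1 + #C.2)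
    (Set.toFinite _) ⟨(univ, univ), fun a _ _ ↦ Or.inl (mem_univ a)⟩
  obtain ⟨f, hf, hfr⟩ := exists_injective_of_minimum_cover r A B hcover
    fun A' B' h ↦ hmin (A', B') h
  obtain ⟨g, hg, hgr⟩ := exists_injective_of_minimum_cover (fun b a ↦ r a b) B A
    (fun b a h ↦ (hcover a b h).symm) fun B' A' h ↦ by
      have := hmin (A', B') fun a b hab ↦ (h b a hab).symm
      simp only at this
      omega
  refine ⟨A, B, univ.image (fun a : A ↦ (a.1, f a)) ∪ univ.image (fun b : B ↦ (g b, b.1)),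
    hcover, fun a ha ↦ ⟨f ⟨a, ha⟩, (hfr _).2, (hfr ⟨a, ha⟩).1⟩,
    fun b hb ↦ ⟨g ⟨b, hb⟩, (hgr _).2, (hgr ⟨b, hb⟩).1⟩, ?_, ?_, ?_, ?_⟩
  · intro p hp
    rcases mem_union.1 hp with hp | hp <;> obtain ⟨x, -, rfl⟩ := mem_image.1 hp
    exacts [(hfr x).1, (hgr x).1]
  · intro p hp q hq hpq
    rcases mem_union.1 (mem_coe.1 hp) with hp | hp <;> obtain ⟨x, -, rfl⟩ := mem_image.1 hp <;>
    rcases mem_union.1 (mem_coe.1 hq) with hq | hq <;> obtain ⟨y, -, rfl⟩ := mem_image.1 hq <;>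
    simp only at hpq
    · rw [Subtype.ext hpq]
    · exact absurd (hpq ▸ x.2) (hgr y).2
    · exact absurd (hpq ▸ y.2) (hgr x).2
    · rw [hg hpq]
  · intro p hp q hq hpq
    rcases mem_union.1 (mem_coe.1 hp) with hp | hp <;> obtain ⟨x, -, rfl⟩ := mem_image.1 hp <;>
    rcases mem_union.1 (mem_coe.1 hq) with hq | hq <;> obtain ⟨y, -, rfl⟩ := mem_image.1 hq <;>
    simp only at hpq
    · rw [hf hpq]
    · exact absurd (hpq ▸ y.2) (hfr x).2
    · exact absurd (hpq ▸ x.2) (hfr y).2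
    · rw [Subtype.ext hpq]
  · rw [card_union_of_disjoint, card_image_of_injective, card_image_of_injective]
    · simp
    · exact fun x y hxy ↦ Subtype.ext (Prod.ext_iff.1 hxy).2
    · exact fun x y hxy ↦ Subtype.ext (Prod.ext_iff.1 hxy).1
    · rw [Finset.disjoint_left]
      intro p hp hq
      obtain ⟨x, -, rfl⟩ := mem_image.1 hp
      obtain ⟨y, -, hy⟩ := mem_image.1 hq
      have hyx : g y = x := (Prod.ext_iff.1 hy).1
      exact (hgr y).2 (hyx ▸ x.2)

open Finset in
/-- The degree sums over the edges of a matching `M` count every edge once, except for the at most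
`#M ^ 2` edges between two matched vertices. -/
theorem sum_degree_matching_le {α β : Type*} [Fintype α] [Fintype β]
    [DecidableEq α] [DecidableEq β] (r : α → β → Prop) [DecidableRel r] (M : Finset (α × β))
    (h₁ : Set.InjOn Prod.fst (M : Set (α × β))) (h₂ : Set.InjOn Prod.snd (M : Set (α × β))) :
    ∑ p ∈ M, (#{b | r p.1 b} + #{a | r a p.2}) ≤ ∑ a, #{b | r a b} + #M * #M := by
  have hsplit : ∀ a, #{b | r a b} + (if a ∈ M.image Prod.fst then #M else 0) ≥
      (if a ∈ M.image Prod.fst then #{b | r a b} else 0) + #{b ∈ M.image Prod.snd | r a b} := by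
    intro a
    split_ifs
    · have := card_filter_le (M.image Prod.snd) (fun b ↦ r a b)
      rw [card_image_of_injOn h₂] at this
      omega
    · have := card_le_card (filter_subset_filter (fun b ↦ r a b) (subset_univ (M.image Prod.snd)))
      omega
  have hsum := sum_le_sum fun a (_ : a ∈ (univ : Finset α)) ↦ hsplit a
  simp only [sum_add_distrib, ← sum_filter, filter_mem_eq_inter, univ_inter, sum_const,
    smul_eq_mul, card_image_of_injOn h₁] at hsum
  have hdouble : ∑ a : α, #{b ∈ M.image Prod.snd | r a b} = ∑ p ∈ M, #{a | r a p.2} := by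
    rw [← sum_image (f := fun b ↦ #{a | r a b}) h₂]
    exact sum_card_bipartiteAbove_eq_sum_card_bipartiteBelow r
  rw [hdouble, sum_image (f := fun a ↦ #{b | r a b}) h₁] at hsum
  rw [sum_add_distrib]
  exact hsum

open Finset in
/-- A sparse relation with bounded degrees, in which related vertices have large degree sum,
has a small vertex cover on one side. -/
theorem exists_cover_one_side {α β : Type*} [Fintype α] [Fintype β]
    [DecidableEq α] [DecidableEq β] (r : α → β → Prop) [DecidableRel r] (n k : ℕ)
    (hr : ∀ a b, r a b → n ≤ #{b | r a b} + #{a | r a b} + 1)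
    (hα : ∀ a b, r a b → #{b | r a b} + k ≤ n)
    (he : ∑ a, #{b | r a b} + k * (k + 1) < k * n) :
    (∃ A : Finset α, #A < k ∧ ∀ a b, r a b → a ∈ A) ∨
    (∃ B : Finset β, #B < k ∧ ∀ a b, r a b → b ∈ B) := by
  obtain ⟨A, B, M, hcover, hA, -, hM, h₁, h₂, hcard⟩ := exists_cover_and_matching r
  have hlt : #A + #B < k := by
    by_contra! hge
    obtain ⟨M', hM', hk⟩ := exists_subset_card_eq (hcard ▸ hge)
    have hle := sum_degree_matching_le r M' (h₁.mono (coe_subset.2 hM'))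
      (h₂.mono (coe_subset.2 hM'))
    have hge' := sum_le_sum fun p (hp : p ∈ M') ↦ hr p.1 p.2 (hM p (hM' hp))
    rw [sum_add_distrib] at hge'
    simp only [sum_const, smul_eq_mul, mul_one, hk] at hge' hle
    nlinarith
  rcases A.eq_empty_or_nonempty with rfl | ⟨a, ha⟩
  · exact Or.inr ⟨B, by simpa using hlt, fun a b hab ↦ (hcover a b hab).resolve_left (by simp)⟩
  · obtain ⟨b, hb, hab⟩ := hA a ha
    have hbA : #{a | r a b} ≤ #A := card_le_card fun x hx ↦
      (hcover x b (mem_filter.1 hx).2).resolve_right hb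
    have := hr a b hab
    have := hα a b hab
    have hB0 : B = ∅ := card_eq_zero.1 (by omega)
    subst hB0
    exact Or.inl ⟨A, by simpa using hlt, fun a b hab ↦ (hcover a b hab).resolve_right (by simp)⟩

theorem deg_add_card_nonneighbors {V : Type*} [Fintype V] [DecidableEq V] (G : SimpleGraph V)
    [DecidableRel G.Adj] (S : Finset V) (v : V) (hS : ∀ u, G.Adj v u → u ∈ S) :
    deg G v + (S.filter fun u ↦ ¬ G.Adj v u).card = S.card := by
  rw [← Finset.card_filter_add_card_filter_not (s := S) (G.Adj v)]
  congr 1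
  rw [deg, ← Set.ncard_coe_finset]
  congr 1
  ext u
  simpa using hS u

theorem numEdges_eq_sum_deg {V : Type*} [Fintype V] [DecidableEq V] (G : SimpleGraph V)
    (X : Finset V) (n : ℕ) (hbip : IsBalancedBipartition G X n) :
    numEdges G = ∑ x ∈ X, deg G x := by
  classical
  have h : G.IsBipartiteWith (X : Set V) (Xᶜ : Finset V) :=
    ⟨Finset.disjoint_coe.2 disjoint_compl_right, fun v w hvw ↦ by
      have := hbip.2.2 v w hvw
      simp only [Finset.mem_coe, Finset.mem_compl]
      tauto⟩
  rw [numEdges, ← coe_edgeFinset, Set.ncard_coe_finset,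
    ← isBipartiteWith_sum_degrees_eq_card_edges h]
  refine Finset.sum_congr rfl fun x _ ↦ ?_
  rw [deg, ← card_neighborFinset_eq_degree, ← Set.ncard_coe_finset, coe_neighborFinset]
  rfl

theorem stmt9 {V : Type*} [Fintype V] [DecidableEq V] (n k : ℕ)
    (G : SimpleGraph V) (X : Finset V)
    (hk : 1 ≤ k) (hn : 2 * k ≤ n)
    (hbip : IsBalancedBipartition G X n)
    (hclosed : ∀ x ∈ X, ∀ y ∈ Xᶜ, ¬ G.Adj x y → deg G x + deg G y ≤ n + 1)
    (he : n * (n - k) + k * (k + 1) < numEdges G)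
    (hδ : ∀ v : V, k ≤ deg G v) :
    (∃ T ⊆ Xᶜ, T.card = n - k + 1 ∧ ∀ x ∈ X, ∀ t ∈ T, G.Adj x t) ∨
    (∃ T ⊆ X, T.card = n - k + 1 ∧ ∀ y ∈ Xᶜ, ∀ t ∈ T, G.Adj y t) := by
  classical
  have hXn := hbip.1
  have hYn := hbip.2.1
  let r : V → V → Prop := fun x y ↦ x ∈ X ∧ y ∈ Xᶜ ∧ ¬ G.Adj x y
  have hX : ∀ x ∈ X, deg G x + (Finset.univ.filter fun y ↦ r x y).card = n := by
    intro x hx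
    rw [← hYn, ← deg_add_card_nonneighbors G Xᶜ x fun u hu ↦
      Finset.mem_compl.2 ((hbip.2.2 x u hu).1 hx)]
    congr 2
    ext y
    simp [r, hx]
  have hY : ∀ y ∈ Xᶜ, deg G y + (Finset.univ.filter fun x ↦ r x y).card = n := by
    intro y hy
    rw [← hXn, ← deg_add_card_nonneighbors G X y fun u hu ↦
      (hbip.2.2 u y hu.symm).2 (Finset.mem_compl.1 hy)]
    congr 2
    ext x
    simp [r, Finset.mem_compl.1 hy, G.adj_comm]
  have hedges : numEdges G + ∑ x, (Finset.univ.filter fun y ↦ r x y).card = n * n := by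
    have hzero : ∑ x ∈ X, (Finset.univ.filter fun y ↦ r x y).card =
        ∑ x, (Finset.univ.filter fun y ↦ r x y).card :=
      Finset.sum_subset (Finset.subset_univ X) fun x _ hx ↦ by simp [r, hx]
    rw [numEdges_eq_sum_deg G X n hbip, ← hzero, ← Finset.sum_add_distrib,
      Finset.sum_congr rfl hX, Finset.sum_const, hXn, smul_eq_mul]
  have hsparse : ∑ x, (Finset.univ.filter fun y ↦ r x y).card + k * (k + 1) < k * n := by
    have : n * (n - k) + k * n = n * n := by
      rw [mul_comm k n, ← mul_add, Nat.sub_add_cancel (by omega)]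
    omega
  rcases exists_cover_one_side r n k
    (fun x y h ↦ by
      have := hX x h.1
      have := hY y h.2.1
      have := hclosed x h.1 y h.2.1 h.2.2
      omega)
    (fun x y h ↦ by
      have := hX x h.1
      have := hδ x
      omega) hsparse with ⟨A, hA, hcover⟩ | ⟨B, hB, hcover⟩
  · have := Finset.le_card_sdiff A X
    obtain ⟨T, hT, hcard⟩ := Finset.exists_subset_card_eq
      (show n - k + 1 ≤ (X \ A).card by omega)
    refine Or.inr ⟨T, hT.trans Finset.sdiff_subset, hcard, fun y hy t ht ↦ ?_⟩
    have htX := Finset.mem_sdiff.1 (hT ht)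
    by_contra h
    exact htX.2 (hcover t y ⟨htX.1, hy, fun h' ↦ h h'.symm⟩)
  · have := Finset.le_card_sdiff B Xᶜ
    obtain ⟨T, hT, hcard⟩ := Finset.exists_subset_card_eq
      (show n - k + 1 ≤ (Xᶜ \ B).card by omega)
    refine Or.inl ⟨T, hT.trans Finset.sdiff_subset, hcard, fun x hx t ht ↦ ?_⟩
    have htX := Finset.mem_sdiff.1 (hT ht)
    by_contra h
    exact htX.2 (hcover x t ⟨hx, htX.1, h⟩)
end

section
/- Let k ≥ 1 and n ≥ 2k, and let G be a balanced bipartite graph of order 2n with parts X and Y, |X| = |Y| = n, such that every vertex of G has degree at least k. If e(G) > n(n−k) + k(k+1), then G is weakly Hamilton-connected. -/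
open SimpleGraph

/-- `f 0, …, f M` is a path of `G` from `x` to `y` without repeated vertices. -/
def IsPathSeq {V : Type*} (G : SimpleGraph V) (M : ℕ) (x y : V) (f : ℕ → V) : Prop :=
  f 0 = x ∧ f M = y ∧ Set.InjOn f (Set.Iic M) ∧ ∀ i < M, G.Adj (f i) (f (i + 1))

lemma IsPathSeq.reverse {V : Type*} {G : SimpleGraph V} {M : ℕ} {x y : V} {f : ℕ → V}
    (h : IsPathSeq G M x y f) : IsPathSeq G M y x (fun i => f (M - i)) := by
  obtain ⟨h0, hM, hinj, hadj⟩ := h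
  refine ⟨by simpa using hM, by simpa using h0, ?_, ?_⟩
  · intro i hi j hj hij
    simp only [Set.mem_Iic] at hi hj
    have := hinj (Set.mem_Iic.2 (Nat.sub_le M i)) (Set.mem_Iic.2 (Nat.sub_le M j)) hij
    omega
  · intro i hi
    have := (hadj (M - (i + 1)) (by omega)).symm
    rwa [show M - (i + 1) + 1 = M - i by omega] at this

lemma IsPathSeq.exists_walk {V : Type*} {G : SimpleGraph V} {f : ℕ → V} (M : ℕ)
    (hadj : ∀ i < M, G.Adj (f i) (f (i + 1))) :
    ∃ p : G.Walk (f 0) (f M), p.support = (List.range (M + 1)).map f := by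
  induction M with
  | zero => exact ⟨Walk.nil, by simp⟩
  | succ M ih =>
    obtain ⟨p, hp⟩ := ih fun i hi => hadj i (by omega)
    refine ⟨p.concat (hadj M (by omega)), ?_⟩
    rw [Walk.support_concat, hp, List.range_succ (n := M + 1)]
    simp

lemma IsPathSeq.exists_isHamiltonian {V : Type*} [Fintype V] [DecidableEq V]
    {G : SimpleGraph V} {M : ℕ} {x y : V} {f : ℕ → V}
    (hcard : Fintype.card V = M + 1) (h : IsPathSeq G M x y f) :
    ∃ p : G.Walk x y, p.IsHamiltonian := by
  obtain ⟨rfl, rfl, hinj, hadj⟩ := h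
  obtain ⟨p, hp⟩ := IsPathSeq.exists_walk M hadj
  have hpath : p.IsPath := by
    rw [Walk.isPath_def, hp]
    refine List.Nodup.map_on ?_ List.nodup_range
    intro i hi j hj hij
    simp only [List.mem_range] at hi hj
    exact hinj (Set.mem_Iic.2 (by omega)) (Set.mem_Iic.2 (by omega)) hij
  refine ⟨p, (Walk.isHamiltonian_iff_isPath_and_length_eq).2 ⟨hpath, ?_⟩⟩
  have := p.length_support
  rw [hp] at this
  simp at this
  omega

/-- Reversing the segment `f (p + 1), …, f q` of a path. -/
lemma exists_isPathSeq_of_lt {V : Type*} {G : SimpleGraph V} {M p q : ℕ} {f : ℕ → V}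
    (hinj : Set.InjOn f (Set.Iic M)) (hpq : p < q) (hq : q < M)
    (hadj : ∀ i < M, i ≠ p → i ≠ q → G.Adj (f i) (f (i + 1)))
    (h₁ : G.Adj (f p) (f q)) (h₂ : G.Adj (f (p + 1)) (f (q + 1))) :
    ∃ g, IsPathSeq G M (f 0) (f M) g := by
  refine ⟨fun t => f (if p < t ∧ t ≤ q then p + 1 + q - t else t), ?_, ?_, ?_, ?_⟩
  · simp
  · beta_reduce; rw [if_neg (by omega)]
  · intro i hi j hj hij
    simp only [Set.mem_Iic] at hi hj
    have := hinj (Set.mem_Iic.2 (by split_ifs <;> omega)) (Set.mem_Iic.2 (by split_ifs <;> omega))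
      hij
    split_ifs at this <;> omega
  · intro t ht
    beta_reduce
    rcases lt_trichotomy t p with h | h | h
    · rw [if_neg (by omega), if_neg (by omega)]
      exact hadj t ht (by omega) (by omega)
    · subst h
      rw [if_neg (by omega), if_pos (by omega), show t + 1 + q - (t + 1) = q by omega]
      exact h₁
    · rcases lt_trichotomy t q with h' | h' | h'
      · rw [if_pos (by omega), if_pos (by omega)]
        have := (hadj (p + q - t) (by omega) (by omega) (by omega)).symm
        rwa [show p + q - t + 1 = p + 1 + q - t by omega,
          show p + q - t = p + 1 + q - (t + 1) by omega] at this
      · subst h'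
        rw [if_pos (by omega), if_neg (by omega), show p + 1 + t - t = p + 1 by omega]
        exact h₂
      · rw [if_neg (by omega), if_neg (by omega)]
        exact hadj t ht (by omega) (by omega)

lemma exists_isPathSeq_of_crossing {V : Type*} {G : SimpleGraph V} {M i j : ℕ} {f : ℕ → V}
    (hinj : Set.InjOn f (Set.Iic M)) (hi : i < M) (hj : j < M)
    (hadj : ∀ t < M, t ≠ i → G.Adj (f t) (f (t + 1)))
    (h₁ : G.Adj (f i) (f j)) (h₂ : G.Adj (f (i + 1)) (f (j + 1))) :
    ∃ g, IsPathSeq G M (f 0) (f M) g := by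
  rcases lt_trichotomy i j with h | rfl | h
  · exact exists_isPathSeq_of_lt hinj h hj (fun t ht hti _ => hadj t ht hti) h₁ h₂
  · exact absurd h₁ (G.loopless.irrefl _)
  · exact exists_isPathSeq_of_lt hinj h hi (fun t ht _ hti => hadj t ht hti) h₁.symm h₂.symm

open Finset in
open scoped Classical in
lemma card_filter_range_comp {V : Type*} [Fintype V] {M : ℕ} {f : ℕ → V}
    (hcard : Fintype.card V = M + 1) (hinj : Set.InjOn f (Set.Iic M)) (p : V → Prop) :
    #{j ∈ range (M + 1) | p (f j)} = #{v | p v} := by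
  have hinj' : Set.InjOn f (range (M + 1) : Finset ℕ) := by
    intro i hi j hj hij
    simp only [coe_range, Set.mem_Iio] at hi hj
    exact hinj (Set.mem_Iic.2 (by omega)) (Set.mem_Iic.2 (by omega)) hij
  have himg : (range (M + 1)).image f = univ := by
    rw [← card_eq_iff_eq_univ, card_image_of_injOn hinj', card_range, hcard]
  rw [← himg, filter_image, card_image_of_injOn]
  exact hinj'.mono (by intro j hj; simp at hj ⊢; omega)

open Finset in
open scoped Classical in
lemma card_filter_range_castSucc {M : ℕ} (p : ℕ → Prop) :
    #{j ∈ range (M + 1) | p j} = #{j ∈ range M | p j} + if p M then 1 else 0 := by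
  simp only [card_filter, sum_range_succ]

open Finset in
open scoped Classical in
lemma card_filter_range_succ' {M : ℕ} (p : ℕ → Prop) :
    #{j ∈ range (M + 1) | p j} = #{j ∈ range M | p (j + 1)} + if p 0 then 1 else 0 := by
  simp only [card_filter, sum_range_succ']

open Finset in
open scoped Classical in
lemma deg_eq_card {V : Type*} [Fintype V] (G : SimpleGraph V) (v : V) :
    deg G v = #{u | G.Adj v u} := by
  rw [deg, Set.ncard_eq_toFinset_card']
  congr 1
  ext; simp

open Finset in
open scoped Classical in
/-- The Bondy–Chvátal type counting: if all steps but the `i`-th one are edges, then large degree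
sum of `f i` and `f (i + 1)` allows to repair the path. -/
lemma exists_isPathSeq_of_deg_add_deg {V : Type*} [Fintype V] [DecidableEq V]
    {G : SimpleGraph V} {X : Finset V} {n M i : ℕ} {f : ℕ → V}
    (hbip : IsBalancedBipartition G X n) (hcard : Fintype.card V = M + 1)
    (hx : f 0 ∈ X) (hy : f M ∉ X)
    (hinj : Set.InjOn f (Set.Iic M)) (hi : i < M)
    (hadj : ∀ t < M, t ≠ i → G.Adj (f t) (f (t + 1)))
    (hside : f i ∈ X ↔ f (i + 1) ∉ X)
    (hdeg : n + 1 ≤ deg G (f i) + deg G (f (i + 1)))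
    (hdeg' : (f i ∈ X → G.Adj (f i) (f M) → G.Adj (f (i + 1)) (f 0) →
      n + 2 ≤ deg G (f i) + deg G (f (i + 1)))) :
    ∃ g, IsPathSeq G M (f 0) (f M) g := by
  obtain ⟨hX, hXc, hb⟩ := hbip
  have halt : ∀ t < M, (f t ∈ X ↔ f (t + 1) ∉ X) := by
    intro t ht
    by_cases h : t = i
    · rw [h]; exact hside
    · exact hb _ _ (hadj t ht h)
  set I : Finset ℕ := {j ∈ range M | G.Adj (f i) (f j)} with hI
  set J : Finset ℕ := {j ∈ range M | G.Adj (f (i + 1)) (f (j + 1))} with hJ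
  set K : Finset ℕ := {j ∈ range M | f j ∈ X ↔ f i ∉ X} with hK
  have hIc : deg G (f i) = #I + if G.Adj (f i) (f M) then 1 else 0 := by
    rw [deg_eq_card, ← card_filter_range_comp hcard hinj, card_filter_range_castSucc]
  have hJc : deg G (f (i + 1)) = #J + if G.Adj (f (i + 1)) (f 0) then 1 else 0 := by
    rw [deg_eq_card, ← card_filter_range_comp hcard hinj,
      card_filter_range_succ' (fun j => G.Adj (f (i + 1)) (f j))]
  have hKc : n = #K + if f i ∈ X then 1 else 0 := by
    have h1 := card_filter_range_comp hcard hinj (fun v => v ∈ X ↔ f i ∉ X)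
    rw [card_filter_range_castSucc] at h1
    have h2 : #{v | v ∈ X ↔ f i ∉ X} = n := by
      by_cases h : f i ∈ X
      · rw [← hXc]; congr 1; ext v; simp [h]
      · rw [← hX]; congr 1; ext v; simp [h]
    simp only [hy, false_iff, not_not] at h1
    rw [← h2]
    convert h1.symm
  have hsub : I ∪ J ⊆ K := by
    intro j hj
    simp only [hI, hJ, hK, mem_union, mem_filter, mem_range] at hj ⊢
    rcases hj with ⟨hj, h⟩ | ⟨hj, h⟩
    · exact ⟨hj, by have := hb _ _ h; tauto⟩
    · exact ⟨hj, by have := hb _ _ h; have := halt j hj; tauto⟩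
  have hne : (I ∩ J).Nonempty := by
    rw [← card_pos]
    have h1 := card_union_add_card_inter I J
    have h2 := card_le_card hsub
    by_cases hiX : f i ∈ X
    · rw [if_pos hiX] at hKc
      specialize hdeg' hiX
      split_ifs at hIc hJc with ha hb'
      · specialize hdeg' ha hb'; omega
      all_goals omega
    · rw [if_neg hiX] at hKc
      rw [if_neg (by intro h; have := hb _ _ h; tauto)] at hIc
      rw [if_neg (by intro h; have := hb _ _ h; tauto)] at hJc
      omega
  obtain ⟨j, hj⟩ := hne
  simp only [hI, hJ, mem_inter, mem_filter, mem_range] at hj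
  exact exists_isPathSeq_of_crossing hinj hi hj.1.1 hadj hj.1.2 hj.2.2

lemma exists_isPathSeq_of_sup_edge {V : Type*} [Fintype V] [DecidableEq V]
    {G : SimpleGraph V} {X : Finset V} {n M : ℕ} {x y u v : V}
    (hbip : IsBalancedBipartition G X n) (hcard : Fintype.card V = M + 1)
    (hx : x ∈ X) (hy : y ∉ X) (hu : u ∈ X) (hv : v ∉ X)
    (h : ∃ f, IsPathSeq (G ⊔ edge u v) M x y f)
    (hdeg : n + 1 ≤ deg G u + deg G v)
    (hdeg' : G.Adj u y → G.Adj x v → n + 2 ≤ deg G u + deg G v) :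
    ∃ f, IsPathSeq G M x y f := by
  obtain ⟨f, rfl, rfl, hinj, hadj⟩ := h
  by_cases hG : ∀ i < M, G.Adj (f i) (f (i + 1))
  · exact ⟨f, rfl, rfl, hinj, hG⟩
  push Not at hG
  obtain ⟨i, hi, hni⟩ := hG
  have hstep : ∀ t < M, ¬ G.Adj (f t) (f (t + 1)) →
      (f t = u ∧ f (t + 1) = v) ∨ (f t = v ∧ f (t + 1) = u) := by
    intro t ht hn
    have := hadj t ht
    rw [sup_adj, edge_adj] at this
    tauto
  have hinj' : ∀ s t, s ≤ M → t ≤ M → f s = f t → s = t := fun s t hs ht e => hinj hs ht e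
  have hrest : ∀ t < M, t ≠ i → G.Adj (f t) (f (t + 1)) := by
    intro t ht hti
    by_contra hn
    rcases hstep t ht hn with ⟨h1, h2⟩ | ⟨h1, h2⟩ <;>
      rcases hstep i hi hni with ⟨h3, h4⟩ | ⟨h3, h4⟩
    · exact hti (hinj' t i (by omega) (by omega) (h1.trans h3.symm))
    · have := hinj' t (i + 1) (by omega) (by omega) (h1.trans h4.symm)
      have := hinj' (t + 1) i (by omega) (by omega) (h2.trans h3.symm)
      omega
    · have := hinj' t (i + 1) (by omega) (by omega) (h1.trans h4.symm)
      have := hinj' (t + 1) i (by omega) (by omega) (h2.trans h3.symm)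
      omega
    · exact hti (hinj' t i (by omega) (by omega) (h1.trans h3.symm))
  rcases hstep i hi hni with ⟨h3, h4⟩ | ⟨h3, h4⟩
  · refine exists_isPathSeq_of_deg_add_deg hbip hcard hx hy hinj hi hrest ?_ ?_ ?_
    · rw [h3, h4]; tauto
    · rw [h3, h4]; exact hdeg
    · rw [h3, h4]; exact fun _ h h' => hdeg' h h'.symm
  · refine exists_isPathSeq_of_deg_add_deg hbip hcard hx hy hinj hi hrest ?_ ?_ ?_
    · rw [h3, h4]; tauto
    · rw [h3, h4, add_comm (deg G v)]; exact hdeg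
    · rw [h3]; exact fun h => absurd h hv

section Relation

open Finset
open scoped Classical

/-- The number of elements of `B` related to `a`. -/
noncomputable def relDeg {α β : Type*} (r : α → β → Prop) (B : Finset β) (a : α) : ℕ :=
  #{b ∈ B | r a b}

/-- The number of non-related pairs in `A × B`. -/
noncomputable def nonRelCount {α β : Type*} (r : α → β → Prop) (A : Finset α) (B : Finset β) : ℕ :=
  #{p ∈ A ×ˢ B | ¬ r p.1 p.2}

/-- A bipartite relation of minimum degree `k` missing few pairs, which is closed under the
degree sum condition for Hamilton paths from `x` to `y`. -/
structure IsClosedRel {α β : Type*} (r : α → β → Prop) (A : Finset α) (B : Finset β) (n k : ℕ)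
    (x : α) (y : β) : Prop where
  card_left : #A = n
  card_right : #B = n
  le : 2 * k ≤ n
  deg_left : ∀ a ∈ A, k ≤ relDeg r B a
  deg_right : ∀ b ∈ B, k ≤ relDeg (fun b a => r a b) A b
  count : nonRelCount r A B + k * (k + 1) < n * k
  closed : ∀ a ∈ A, ∀ b ∈ B, ¬ r a b → relDeg r B a + relDeg (fun b a => r a b) A b ≤ n + 1
  closed' : ∀ a ∈ A, ∀ b ∈ B, ¬ r a b → n + 1 ≤ relDeg r B a + relDeg (fun b a => r a b) A b →
    r a y ∧ r x b

/-- All pairs are related, except possibly those in `S × (B \ T)`, where `#T = #S + 1`. -/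
def IsNearlyComplete {α β : Type*} (r : α → β → Prop) (A : Finset α) (B : Finset β)
    (x : α) (y : β) : Prop :=
  ∃ S ⊆ A, ∃ T ⊆ B, x ∉ S ∧ y ∈ T ∧ #T = #S + 1 ∧ ∀ a ∈ A, ∀ b ∈ B, a ∉ S ∨ b ∈ T → r a b

variable {α β : Type*} {r : α → β → Prop} {A : Finset α} {B : Finset β} {n k : ℕ} {x : α} {y : β}

lemma nonRelCount_eq_sum : nonRelCount r A B = ∑ a ∈ A, #{b ∈ B | ¬ r a b} := by
  simp only [nonRelCount, card_filter, sum_product]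

lemma nonRelCount_flip : nonRelCount (fun b a => r a b) B A = nonRelCount r A B := by
  simp only [nonRelCount, card_filter, sum_product]
  exact sum_comm

lemma nonRelCount_mono {S : Finset α} {T : Finset β} (hS : S ⊆ A) (hT : T ⊆ B) :
    nonRelCount r S T ≤ nonRelCount r A B :=
  card_le_card (filter_subset_filter _ (product_subset_product hS hT))

lemma card_filter_not_add_relDeg (a : α) : #{b ∈ B | ¬ r a b} + relDeg r B a = #B := by
  rw [relDeg, add_comm, card_filter_add_card_filter_not]

lemma card_mul_le_nonRelCount {S : Finset α} {e : ℕ} (h : ∀ a ∈ S, relDeg r B a ≤ e) :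
    #S * (#B - e) ≤ nonRelCount r S B := by
  rw [nonRelCount_eq_sum, ← smul_eq_mul]
  refine card_nsmul_le_sum _ _ _ fun a ha => ?_
  have := card_filter_not_add_relDeg (r := r) (B := B) a
  have := h a ha
  omega

lemma IsClosedRel.flip (h : IsClosedRel r A B n k x y) :
    IsClosedRel (fun b a => r a b) B A n k y x where
  card_left := h.card_right
  card_right := h.card_left
  le := h.le
  deg_left := h.deg_right
  deg_right := h.deg_left
  count := by rw [nonRelCount_flip]; exact h.count
  closed b hb a ha hab := by rw [add_comm]; exact h.closed a ha b hb hab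
  closed' b hb a ha hab hs := (h.closed' a ha b hb hab (hs.trans_eq (add_comm _ _))).symm

lemma IsClosedRel.false_of_forall_le (h : IsClosedRel r A B n k x y) {a : α} {b : β} (ha : a ∈ A)
    (hb : b ∈ B) (hab : ¬ r a b) (hka : k < relDeg r B a)
    (hle : relDeg r B a ≤ relDeg (fun b a => r a b) A b)
    (hmax : ∀ a' ∈ A, ¬ r a' b → relDeg r B a' ≤ relDeg r B a) : False := by
  have h1 := card_mul_le_nonRelCount (r := r) (S := {a' ∈ A | ¬ r a' b}) (B := B)
    (e := relDeg r B a) (fun a' ha' => by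
      rw [mem_filter] at ha'
      exact hmax a' ha'.1 ha'.2)
  have h2 := nonRelCount_mono (r := r) (filter_subset (fun a' => ¬ r a' b) A) (subset_refl B)
  have h3 := card_filter_not_add_relDeg (r := fun b a => r a b) (B := A) b
  have h4 := h.closed a ha b hb hab
  have h5 := h.count
  rw [h.card_right] at h1
  rw [h.card_left] at h3
  generalize relDeg r B a = s at *
  generalize relDeg (fun b a => r a b) A b = t at *
  generalize nonRelCount r A B = m at *
  have h6 := h1.trans h2
  obtain ⟨i, rfl⟩ := Nat.exists_eq_add_of_lt hka
  obtain ⟨j, rfl⟩ : ∃ j, n = 2 * k + 1 + 2 * i + j := ⟨n - (2 * k + 1 + 2 * i), by omega⟩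
  have h7 : (k + i) * (k + i + j) ≤ m := by
    refine (Nat.mul_le_mul ?_ ?_).trans h6 <;> omega
  nlinarith

lemma IsClosedRel.rel_of_lt (h : IsClosedRel r A B n k x y) {a : α} {b : β} (ha : a ∈ A)
    (hb : b ∈ B) (hka : k < relDeg r B a) (hkb : k < relDeg (fun b a => r a b) A b) : r a b := by
  by_contra hab
  obtain ⟨⟨a, b⟩, hp, hmax⟩ := exists_max_image
    {p ∈ A ×ˢ B | ¬ r p.1 p.2 ∧ k < relDeg r B p.1 ∧ k < relDeg (fun b a => r a b) A p.2}
    (fun p => relDeg r B p.1 + relDeg (fun b a => r a b) A p.2)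
    ⟨(a, b), by simp [ha, hb, hab, hka, hkb]⟩
  simp only [mem_filter, mem_product, Prod.forall] at hp hmax
  obtain ⟨⟨ha, hb⟩, hab, hka, hkb⟩ := hp
  rcases le_total (relDeg r B a) (relDeg (fun b a => r a b) A b) with hle | hle
  · refine h.false_of_forall_le ha hb hab hka hle fun a' ha' hab' => ?_
    by_contra hlt
    have := hmax a' b ⟨⟨ha', hb⟩, hab', by omega, hkb⟩
    omega
  · refine h.flip.false_of_forall_le hb ha hab hkb hle fun b' hb' hab' => ?_
    by_contra hlt
    have := hmax a b' ⟨⟨ha, hb'⟩, hab', hka, by omega⟩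
    omega

lemma IsClosedRel.card_lt (h : IsClosedRel r A B n k x y) : #{a ∈ A | relDeg r B a ≤ k} < k := by
  by_contra! hc
  have h1 := card_mul_le_nonRelCount (r := r) (S := {a ∈ A | relDeg r B a ≤ k}) (B := B)
    (e := k) (fun a ha => (mem_filter.1 ha).2)
  have h2 := nonRelCount_mono (r := r) (filter_subset (fun a => relDeg r B a ≤ k) A) (subset_refl B)
  have h3 := h.count
  have h4 := Nat.mul_le_mul_right (n - k) hc
  rw [h.card_right] at h1
  obtain ⟨j, rfl⟩ := Nat.exists_eq_add_of_le h.le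
  rw [show 2 * k + j - k = k + j by omega] at *
  nlinarith

lemma IsClosedRel.card_eq_of_not_rel (h : IsClosedRel r A B n k x y) {a : α} {b : β} (ha : a ∈ A)
    (hb : b ∈ B) (hab : ¬ r a b) (hkb : k < relDeg (fun b a => r a b) A b) :
    #{a ∈ A | relDeg r B a ≤ k} + 1 = k ∧ relDeg r B a = k ∧ r a y ∧ r x b ∧
      ∀ a' ∈ A, relDeg r B a' ≤ k → ¬ r a' b := by
  have hsub : ({a' ∈ A | ¬ r a' b} : Finset α) ⊆ {a' ∈ A | relDeg r B a' ≤ k} := by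
    intro a' ha'
    simp only [mem_filter] at ha' ⊢
    refine ⟨ha'.1, ?_⟩
    by_contra! hlt
    exact ha'.2 (h.rel_of_lt ha'.1 hb hlt hkb)
  have h1 := card_le_card hsub
  have h2 := h.card_lt
  have h3 := h.closed a ha b hb hab
  have h4 := h.deg_left a ha
  have h5 := card_filter_not_add_relDeg (r := fun b a => r a b) (B := A) b
  rw [h.card_left] at h5
  have h6 := h.closed' a ha b hb hab (by omega)
  have heq := eq_of_subset_of_card_le hsub (by omega)
  refine ⟨by omega, by omega, h6.1, h6.2, fun a' ha' hk' => ?_⟩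
  have : a' ∈ ({a' ∈ A | ¬ r a' b} : Finset α) := by
    rw [heq]; exact mem_filter.2 ⟨ha', hk'⟩
  exact (mem_filter.1 this).2

lemma IsClosedRel.card_eq_of_nonempty (h : IsClosedRel r A B n k x y) {a : α} (ha : a ∈ A)
    (hka : relDeg r B a ≤ k) : #{a ∈ A | relDeg r B a ≤ k} + 1 = k := by
  have h1 := h.flip.card_lt
  have h2 := card_filter_not_add_relDeg (r := r) (B := B) a
  rw [h.card_right] at h2
  have h3 := h.le
  obtain ⟨b, hb, hb'⟩ := exists_mem_notMem_of_card_lt_card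
    (s := ({b ∈ B | relDeg (fun b a => r a b) A b ≤ k} : Finset β)) (t := {b ∈ B | ¬ r a b})
    (by omega)
  rw [mem_filter] at hb hb'
  exact (h.card_eq_of_not_rel ha hb.1 hb.2 (by by_contra hlt; exact hb' ⟨hb.1, by omega⟩)).1

lemma IsClosedRel.false_of_le_of_le (h : IsClosedRel r A B n k x y) {a : α} {b : β} (ha : a ∈ A)
    (hb : b ∈ B) (hka : relDeg r B a ≤ k) (hkb : relDeg (fun b a => r a b) A b ≤ k) : False := by
  have hS := h.card_eq_of_nonempty ha hka
  have hT := h.flip.card_eq_of_nonempty hb hkb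
  have hS0 : 0 < #{a ∈ A | relDeg r B a ≤ k} := card_pos.2 ⟨a, mem_filter.2 ⟨ha, hka⟩⟩
  set S : Finset α := {a ∈ A | relDeg r B a ≤ k} with hSdef
  set T : Finset β := {b ∈ B | relDeg (fun b a => r a b) A b ≤ k} with hTdef
  have h1 := card_mul_le_nonRelCount (r := r) (S := S) (B := B)
    (e := k) (fun a ha => (mem_filter.1 ha).2)
  have h2 := card_mul_le_nonRelCount (r := fun b a => r a b) (S := T) (B := A)
    (e := k) (fun b hb => (mem_filter.1 hb).2)
  rw [nonRelCount_flip] at h2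
  have h3 : nonRelCount r S B + nonRelCount r A T ≤ nonRelCount r A B + #S * #T := by
    rw [← card_product, nonRelCount, nonRelCount, ← card_union_add_card_inter]
    refine add_le_add (card_le_card ?_) (card_le_card ?_)
    · exact union_subset
        (filter_subset_filter _ (product_subset_product (filter_subset _ _) (subset_refl _)))
        (filter_subset_filter _ (product_subset_product (subset_refl _) (filter_subset _ _)))
    · intro p hp
      simp only [mem_inter, mem_filter, mem_product] at hp ⊢
      exact ⟨hp.1.1.1, hp.2.1.2⟩
  have h4 := h.count
  have h5 := h.le
  rw [h.card_right] at h1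
  rw [h.card_left] at h2
  have hTS : #T = #S := by omega
  rw [hTS] at h2 h3
  clear_value S T
  generalize #S = s at *
  subst hS
  obtain ⟨j, rfl⟩ := Nat.exists_eq_add_of_le h5
  rw [show 2 * (s + 1) + j - (s + 1) = s + 1 + j by omega] at h1 h2
  nlinarith

lemma IsClosedRel.isNearlyComplete_of_forall_lt (h : IsClosedRel r A B n k x y)
    (hx : x ∈ A) (hy : y ∈ B) (hB : ∀ b ∈ B, k < relDeg (fun b a => r a b) A b) :
    IsNearlyComplete r A B x y := by
  by_cases hall : ∀ a ∈ A, ∀ b ∈ B, r a b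
  · exact ⟨∅, by simp, {y}, by simpa using hy, by simp, by simp, by simp,
      fun a ha b hb _ => hall a ha b hb⟩
  push Not at hall
  obtain ⟨a₀, ha₀, b₀, hb₀, hab₀⟩ := hall
  obtain ⟨hS, hda₀, -, hxb₀, hSb₀⟩ := h.card_eq_of_not_rel ha₀ hb₀ hab₀ (hB b₀ hb₀)
  refine ⟨{a ∈ A | relDeg r B a ≤ k}, filter_subset _ _, {b ∈ B | r a₀ b}, filter_subset _ _,
    ?_, ?_, ?_, ?_⟩
  · intro hxS
    exact hSb₀ x hx (mem_filter.1 hxS).2 hxb₀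
  · exact mem_filter.2 ⟨hy, (h.card_eq_of_not_rel ha₀ hb₀ hab₀ (hB b₀ hb₀)).2.2.1⟩
  · rw [hS]; exact hda₀
  · intro a ha b hb hor
    by_contra hab
    obtain ⟨-, hda, -, -, hSb⟩ := h.card_eq_of_not_rel ha hb hab (hB b hb)
    rcases hor with hor | hor
    · exact hor (mem_filter.2 ⟨ha, hda.le⟩)
    · exact hSb a₀ ha₀ hda₀.le (mem_filter.1 hor).2

lemma IsClosedRel.isNearlyComplete (h : IsClosedRel r A B n k x y) (hx : x ∈ A) (hy : y ∈ B) :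
    IsNearlyComplete r A B x y ∨ IsNearlyComplete (fun b a => r a b) B A y x := by
  by_cases hB : ∀ b ∈ B, k < relDeg (fun b a => r a b) A b
  · exact .inl (h.isNearlyComplete_of_forall_lt hx hy hB)
  · push Not at hB
    obtain ⟨b, hb, hkb⟩ := hB
    refine .inr (h.flip.isNearlyComplete_of_forall_lt hy hx fun a ha => ?_)
    by_contra! hka
    exact h.false_of_le_of_le ha hb hka hkb

end Relation

section Construction

open Finset

lemma exists_injOn_mapsTo_Iio_card {V : Type*} [Nonempty V] (C : Finset V) :
    ∃ f : ℕ → V, (∀ i < #C, f i ∈ C) ∧ Set.InjOn f (Set.Iio #C) := by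
  classical
  refine ⟨fun i => if h : i < #C then C.equivFin.symm ⟨i, h⟩ else Classical.arbitrary V, ?_, ?_⟩
  · intro i hi
    simp [hi]
  · intro i hi j hj hij
    simp only [Set.mem_Iio] at hi hj
    simpa [hi, hj, Subtype.ext_iff] using hij

/-- An enumeration of `A` that starts with the elements of `C` and ends with `x`. -/
lemma exists_enumeration_s10 {V : Type*} {A C : Finset V} {x : V} (hC : C ⊆ A)
    (hx : x ∈ A) (hxC : x ∉ C) :
    ∃ f : ℕ → V, f (#A - 1) = x ∧ (∀ i < #A, f i ∈ A) ∧ (∀ i < #A, (f i ∈ C ↔ i < #C)) ∧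
      Set.InjOn f (Set.Iio #A) := by
  classical
  have : Nonempty V := ⟨x⟩
  obtain ⟨g, hgC, hg⟩ := exists_injOn_mapsTo_Iio_card C
  obtain ⟨h, hhD, hh⟩ := exists_injOn_mapsTo_Iio_card ((A \ C).erase x)
  have hcard : #((A \ C).erase x) + 1 + #C = #A := by
    rw [card_erase_add_one (mem_sdiff.2 ⟨hx, hxC⟩), card_sdiff_add_card_eq_card hC]
  have hh' : ∀ i < #((A \ C).erase x), h i ≠ x ∧ h i ∈ A ∧ h i ∉ C := by
    intro i hi
    have := hhD i hi
    rwa [mem_erase, mem_sdiff] at this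
  generalize #((A \ C).erase x) = d at *
  refine ⟨fun i => if i < #C then g i else if i + 1 < #A then h (i - #C) else x, ?_, ?_, ?_, ?_⟩
  · beta_reduce
    rw [if_neg (by omega), if_neg (by omega)]
  · intro i hi
    beta_reduce
    split_ifs with h1 h2
    · exact hC (hgC i h1)
    · exact (hh' _ (by omega)).2.1
    · exact hx
  · intro i hi
    beta_reduce
    split_ifs with h1 h2
    · exact iff_of_true (hgC i h1) h1
    · exact iff_of_false (hh' _ (by omega)).2.2 h1
    · exact iff_of_false hxC h1
  · intro i hi j hj hij
    simp only [Set.mem_Iio] at hi hj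
    beta_reduce at hij
    split_ifs at hij with h1 h2 h3 h4 h5 h6 h7
    · exact hg h1 h2 hij
    · exact absurd (hij ▸ hgC i h1) (hh' _ (by omega)).2.2
    · exact absurd (hij ▸ hgC i h1) hxC
    · exact absurd (hij ▸ hgC j h5) (hh' _ (by omega)).2.2
    · have := hh (Set.mem_Iio.2 (by omega)) (Set.mem_Iio.2 (by omega)) hij
      omega
    · exact absurd hij (hh' _ (by omega)).1
    · exact absurd (hij ▸ hgC j h7) hxC
    · exact absurd hij.symm (hh' _ (by omega)).1
    · omega

lemma IsNearlyComplete.exists_isPathSeq {V : Type*} {G : SimpleGraph V} {A B : Finset V}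
    {n : ℕ} {x y : V} (hdisj : Disjoint A B) (hA : #A = n) (hB : #B = n) (hx : x ∈ A)
    (hy : y ∈ B) (h : IsNearlyComplete G.Adj A B x y) :
    ∃ f, IsPathSeq G (2 * n - 1) y x f := by
  classical
  obtain ⟨S, hS, T, hT, hxS, hyT, hcard, hadj⟩ := h
  have hn : 0 < n := hA ▸ card_pos.2 ⟨x, hx⟩
  obtain ⟨a, hax, haA, haS, ha⟩ := exists_enumeration_s10 hS hx hxS
  obtain ⟨b, hby, hbB, hbT, hb⟩ := exists_enumeration_s10 (sdiff_subset (s := B) (t := T)) hy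
    (by simp [hyT])
  have hBT := card_sdiff_add_card_eq_card hT
  have hSA := card_le_card hS
  generalize #(B \ T) = c at *
  rw [hA] at hax haA haS ha
  rw [hB] at hby hbB hbT hb
  have key : ∀ i < n, ∀ j < n, i ≤ j + 1 → G.Adj (a j) (b (n - 1 - i)) := by
    intro i hi j hj hij
    refine hadj _ (haA j hj) _ (hbB _ (by omega)) ?_
    rw [haS j hj]
    by_cases hjs : j < #S
    · right
      by_contra hT'
      have := (hbT (n - 1 - i) (by omega)).1 (mem_sdiff.2 ⟨hbB _ (by omega), hT'⟩)
      omega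
    · exact .inl hjs
  have hab : ∀ i < n, ∀ j < n, a i ≠ b j := fun i hi j hj e =>
    disjoint_left.1 hdisj (haA i hi) (e ▸ hbB j hj)
  refine ⟨fun j => if j % 2 = 0 then b (n - 1 - j / 2) else a (j / 2), ?_, ?_, ?_, ?_⟩
  · simpa using hby
  · beta_reduce
    rw [if_neg (by omega), show (2 * n - 1) / 2 = n - 1 by omega, hax]
  · intro i hi j hj hij
    simp only [Set.mem_Iic] at hi hj
    beta_reduce at hij
    split_ifs at hij
    · have := hb (Set.mem_Iio.2 (by omega)) (Set.mem_Iio.2 (by omega)) hij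
      omega
    · exact absurd hij.symm (hab _ (by omega) _ (by omega))
    · exact absurd hij (hab _ (by omega) _ (by omega))
    · have := ha (Set.mem_Iio.2 (by omega)) (Set.mem_Iio.2 (by omega)) hij
      omega
  · intro i hi
    beta_reduce
    rcases Nat.mod_two_eq_zero_or_one i with h | h
    · rw [if_pos h, if_neg (by omega)]
      exact (key _ (by omega) _ (by omega) (by omega)).symm
    · rw [if_neg (by omega), if_pos (by omega)]
      exact key _ (by omega) _ (by omega) (by omega)

end Construction

open Finset in
lemma relDeg_adj {V : Type*} [Fintype V] (G : SimpleGraph V) {B : Finset V} {v : V}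
    (h : ∀ u, G.Adj v u → u ∈ B) : relDeg G.Adj B v = deg G v := by
  classical
  rw [relDeg, deg_eq_card]
  congr 1
  ext u
  simpa using h u

lemma flip_adj {V : Type*} (G : SimpleGraph V) : (fun b a => G.Adj a b) = G.Adj := by
  ext b a
  exact G.adj_comm a b

lemma deg_mono {V : Type*} [Fintype V] {G H : SimpleGraph V} (h : G ≤ H) (v : V) :
    deg G v ≤ deg H v :=
  Set.ncard_le_ncard (fun _ hu => h hu) (Set.toFinite _)

lemma numEdges_mono {V : Type*} [Fintype V] {G H : SimpleGraph V} (h : G ≤ H) :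
    numEdges G ≤ numEdges H :=
  Set.ncard_le_ncard (edgeSet_mono h) (Set.toFinite _)

open Finset in
lemma nonRelCount_add_numEdges {V : Type*} [Fintype V] [DecidableEq V] {G : SimpleGraph V}
    {X : Finset V} {n : ℕ} (hbip : IsBalancedBipartition G X n) :
    nonRelCount G.Adj X Xᶜ + numEdges G = n * n := by
  classical
  obtain ⟨hX, hXc, hb⟩ := hbip
  have hB : G.IsBipartiteWith (X : Set V) ((Xᶜ : Finset V) : Set V) :=
    ⟨by rw [disjoint_coe]; exact disjoint_compl_right, fun v w hvw => by
      have := hb v w hvw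
      simp only [mem_coe, mem_compl]
      tauto⟩
  have hE : numEdges G = ∑ v ∈ X, deg G v := by
    rw [numEdges, Set.ncard_eq_toFinset_card', ← edgeFinset,
      ← isBipartiteWith_sum_degrees_eq_card_edges hB]
    refine sum_congr rfl fun v _ => ?_
    rw [deg_eq_card, ← card_neighborFinset_eq_degree]
    congr 1
    ext; simp
  rw [hE, nonRelCount_eq_sum, ← sum_add_distrib, sum_congr rfl (g := fun _ => n), sum_const, hX,
    smul_eq_mul]
  intro v hv
  rw [← relDeg_adj G (B := Xᶜ) fun u hu => mem_compl.2 ((hb v u hu).1 hv),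
    card_filter_not_add_relDeg, hXc]

lemma IsBalancedBipartition.isClosedRel {V : Type*} [Fintype V] [DecidableEq V]
    {G : SimpleGraph V} {X : Finset V} {n k M : ℕ} {x y : V} (hn : 2 * k ≤ n)
    (hbip : IsBalancedBipartition G X n) (hδ : ∀ v : V, k ≤ deg G v)
    (he : n * (n - k) + k * (k + 1) < numEdges G) (hcard : Fintype.card V = M + 1)
    (hx : x ∈ X) (hy : y ∉ X)
    (hmax : Maximal
      (fun H => IsBalancedBipartition H X n ∧ ¬ ∃ f, IsPathSeq H M x y f) G) :
    IsClosedRel G.Adj X Xᶜ n k x y := by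
  have hdX : ∀ a ∈ X, relDeg G.Adj Xᶜ a = deg G a := fun a ha =>
    relDeg_adj G fun u hu => Finset.mem_compl.2 ((hbip.2.2 a u hu).1 ha)
  have hdY : ∀ b ∈ Xᶜ, relDeg (fun b a => G.Adj a b) X b = deg G b := fun b hb => by
    rw [flip_adj]
    refine relDeg_adj G fun u hu => ?_
    have := hbip.2.2 b u hu
    rw [Finset.mem_compl] at hb
    tauto
  have hpath : ∀ a ∈ X, ∀ b ∈ Xᶜ, ¬ G.Adj a b → ∃ f, IsPathSeq (G ⊔ edge a b) M x y f := by
    intro a ha b hb hab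
    rw [Finset.mem_compl] at hb
    have hne : a ≠ b := by rintro rfl; exact hb ha
    by_contra hno
    refine hab (hmax.2 ⟨⟨hbip.1, hbip.2.1, fun u v huv => ?_⟩, hno⟩ le_sup_left
      (show (G ⊔ edge a b).Adj a b by simp [edge_adj, hne]))
    rw [sup_adj, edge_adj] at huv
    rcases huv with huv | ⟨⟨rfl, rfl⟩ | ⟨rfl, rfl⟩, -⟩
    · exact hbip.2.2 u v huv
    · tauto
    · tauto
  refine ⟨hbip.1, hbip.2.1, hn, ?_, ?_, ?_, ?_, ?_⟩
  · exact fun a ha => (hdX a ha).symm ▸ hδ a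
  · exact fun b hb => (hdY b hb).symm ▸ hδ b
  · have h1 := nonRelCount_add_numEdges hbip
    have h2 : n * (n - k) + n * k = n * n := by
      rw [← mul_add, Nat.sub_add_cancel (by omega)]
    omega
  · intro a ha b hb hab
    rw [hdX a ha, hdY b hb]
    by_contra! hlt
    exact hmax.1.2 (exists_isPathSeq_of_sup_edge hbip hcard hx hy ha (Finset.mem_compl.1 hb)
      (hpath a ha b hb hab) (by omega) fun _ _ => by omega)
  · intro a ha b hb hab hle
    rw [hdX a ha, hdY b hb] at hle
    by_contra hno
    exact hmax.1.2 (exists_isPathSeq_of_sup_edge hbip hcard hx hy ha (Finset.mem_compl.1 hb)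
      (hpath a ha b hb hab) hle fun h h' => absurd ⟨h, h'⟩ hno)

theorem stmt10 {V : Type*} [Fintype V] [DecidableEq V] (n k : ℕ)
    (G : SimpleGraph V) (X : Finset V)
    (hk : 1 ≤ k) (hn : 2 * k ≤ n)
    (hbip : IsBalancedBipartition G X n)
    (hδ : ∀ v : V, k ≤ deg G v)
    (he : n * (n - k) + k * (k + 1) < numEdges G) :
    WeaklyHamiltonConnected G X := by
  intro x hx y hy
  have hV : Fintype.card V = 2 * n - 1 + 1 := by
    have := X.card_add_card_compl
    rw [hbip.1, hbip.2.1] at this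
    omega
  suffices h : ∃ f, IsPathSeq G (2 * n - 1) x y f by
    obtain ⟨f, hf⟩ := h
    exact hf.exists_isHamiltonian hV
  by_contra hno
  obtain ⟨H, hGH, hmax⟩ := Finite.exists_le_maximal
    (p := fun H => IsBalancedBipartition H X n ∧ ¬ ∃ f, IsPathSeq H (2 * n - 1) x y f)
    ⟨hbip, hno⟩
  have hclosed := hmax.1.1.isClosedRel hn (fun v => (hδ v).trans (deg_mono hGH v))
    (he.trans_le (numEdges_mono hGH)) hV hx (Finset.mem_compl.1 hy) hmax
  refine hmax.1.2 ?_
  rcases hclosed.isNearlyComplete hx hy with h | h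
  · obtain ⟨f, hf⟩ := h.exists_isPathSeq disjoint_compl_right hbip.1 hbip.2.1 hx hy
    exact ⟨_, hf.reverse⟩
  · rw [flip_adj] at h
    exact IsNearlyComplete.exists_isPathSeq disjoint_compl_left hbip.2.1 hbip.1 hy hx h
end
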